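/- arXiv:1901.03980 — 4 statements merged into one kernel-verified Lean document; each statement's English description precedes it below -/
import Mathlib

section
/- Let n ≥ 4 be even and let G = ⟨α, τ | α^n = τ^2 = 1_G, τα = α^{-1}τ⟩ be a dihedral group of order 2n. Then there is no minimal product-one sequence S over G such that S = S_1 · S_2 where S_1 is a sequence with all terms in ⟨α⟩ and S_2 is a sequence with all terms in G \ ⟨α⟩ of length |S_2| ≥ n + 2. -/
/-- A multiset over a group is a *product-one sequence* if its terms can be
ordered so that their product is `1`. -/
def IsProductOne {G : Type*} [Group G] (S : Multiset G) : Prop :=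
  ∃ l : List G, (l : Multiset G) = S ∧ l.prod = 1

/-- A product-one sequence is *minimal* if it is non-trivial and cannot be written
as a concatenation of two non-trivial product-one sequences. -/
def IsMinimalProductOne {G : Type*} [Group G] (S : Multiset G) : Prop :=
  S ≠ 0 ∧ IsProductOne S ∧
    ∀ T₁ T₂ : Multiset G, T₁ ≠ 0 → T₂ ≠ 0 → IsProductOne T₁ → IsProductOne T₂ →
      S ≠ T₁ + T₂

section SubsetSums

variable {ι N : Type*} [AddCommGroup N]

/-- The set of all subset sums of a multiset, weighted by `f`. -/
def subSums (f : ι → N) (P : Multiset ι) : Set N := {s | ∃ J ≤ P, (J.map f).sum = s}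

theorem zero_mem_subSums (f : ι → N) (P : Multiset ι) : (0 : N) ∈ subSums f P :=
  ⟨0, Multiset.zero_le _, by simp⟩

theorem subSums_mono (f : ι → N) {P Q : Multiset ι} (h : P ≤ Q) : subSums f P ⊆ subSums f Q := by
  rintro s ⟨J, hJ, rfl⟩
  exact ⟨J, hJ.trans h, rfl⟩

theorem mem_subSums_cons (f : ι → N) (p : ι) (P : Multiset ι) (s : N) :
    s ∈ subSums f (p ::ₘ P) ↔ s ∈ subSums f P ∨ ∃ y ∈ subSums f P, s = f p + y := by
  classical
  constructor
  · rintro ⟨J, hJ, rfl⟩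
    by_cases hp : p ∈ J
    · obtain ⟨K, rfl⟩ := Multiset.exists_cons_of_mem hp
      right
      exact ⟨_, ⟨K, (Multiset.cons_le_cons_iff p).1 hJ, rfl⟩, by simp⟩
    · left
      exact ⟨J, (Multiset.le_cons_of_notMem hp).1 hJ, rfl⟩
  · rintro (h | ⟨y, ⟨J, hJ, rfl⟩, rfl⟩)
    · exact subSums_mono f (Multiset.le_cons_self _ _) h
    · exact ⟨p ::ₘ J, (Multiset.cons_le_cons_iff p).2 hJ, by simp⟩

/-- If adding one element does not enlarge the set of subset sums, the element stabilizes it. -/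
theorem subSums_grow [Finite N] (f : ι → N) (p : ι) (P : Multiset ι)
    (h : ¬ ∀ y ∈ subSums f P, f p + y ∈ subSums f P) :
    (subSums f P).ncard + 1 ≤ (subSums f (p ::ₘ P)).ncard := by
  push Not at h
  obtain ⟨y, hy, hn⟩ := h
  apply Set.ncard_lt_ncard _ (Set.toFinite _)
  refine ⟨subSums_mono f (Multiset.le_cons_self _ _), fun hs => hn (hs ?_)⟩
  exact (mem_subSums_cons f p P _).2 (Or.inr ⟨y, hy, rfl⟩)

theorem neg_mem_of_stab [Finite N] (X : Set N) (g : N) (h : ∀ y ∈ X, g + y ∈ X) :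
    ∀ y ∈ X, ∃ z ∈ X, g + z = y := by
  have hm : Set.MapsTo (fun y => g + y) X X := h
  have himg : Set.image (fun y => g + y) X = X := by
    apply Set.eq_of_subset_of_ncard_le hm.image_subset _ (Set.toFinite _)
    rw [Set.ncard_image_of_injective X (add_right_injective g)]
  intro y hy
  rw [← himg] at hy
  obtain ⟨z, hz, h⟩ := hy
  exact ⟨z, hz, h⟩

theorem card_le_of_zsf [Finite N] (f : ι → N) (P : Multiset ι)
    (h : ∀ J ≤ P, J ≠ 0 → (J.map f).sum ≠ 0) :
    Multiset.card P + 1 ≤ (subSums f P).ncard := by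
  induction P using Multiset.induction with
  | empty =>
    simp only [Multiset.card_zero, zero_add]
    exact (Set.ncard_pos (Set.toFinite _)).2 ⟨0, zero_mem_subSums f _⟩
  | cons p P ih =>
    have ih' := ih (fun J hJ => h J (hJ.trans (Multiset.le_cons_self _ _)))
    have := subSums_grow f p P (fun hst => by
      obtain ⟨z, ⟨J, hJ, rfl⟩, hz⟩ := neg_mem_of_stab _ _ hst 0 (zero_mem_subSums f P)
      exact h (p ::ₘ J) ((Multiset.cons_le_cons_iff p).2 hJ) (Multiset.cons_ne_zero) (by simpa using hz))
    rw [Multiset.card_cons]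
    omega

open Classical in
theorem card_le_of_aperiodic [Finite N] (f : ι → N) (P : Multiset ι)
    (h : ∀ g, (∀ y ∈ subSums f P, g + y ∈ subSums f P) → g = 0) :
    Multiset.card (P.filter (fun p => f p ≠ 0)) + 1 ≤ (subSums f P).ncard := by
  induction P using Multiset.induction with
  | empty =>
    simp only [Multiset.filter_zero, Multiset.card_zero, zero_add]
    exact (Set.ncard_pos (Set.toFinite _)).2 ⟨0, zero_mem_subSums f _⟩
  | cons p P ih =>
    have hst : ∀ g, (∀ y ∈ subSums f P, g + y ∈ subSums f P) → g = 0 := by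
      intro g hg
      apply h
      intro y hy
      rw [mem_subSums_cons] at hy ⊢
      rcases hy with hy | ⟨z, hz, rfl⟩
      · exact Or.inl (hg y hy)
      · exact Or.inr ⟨g + z, hg z hz, by abel⟩
    have ih' := ih hst
    by_cases hp : f p = 0
    · rw [Multiset.filter_cons_of_neg _ (by simpa using hp)]
      exact ih'.trans (Set.ncard_le_ncard (subSums_mono f (Multiset.le_cons_self _ _)) (Set.toFinite _))
    · rw [Multiset.filter_cons_of_pos _ (by simpa using hp), Multiset.card_cons]
      have := subSums_grow f p P (fun hs => hp (hst _ hs))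
      omega

theorem eq_of_missing {N : Type*} [Finite N] (T X : Set N) (hX : X ⊆ T) (hc : T.ncard ≤ X.ncard + 1)
    (x y : N) (hx : x ∈ T) (hy : y ∈ T) (hx' : x ∉ X) (hy' : y ∉ X) : x = y := by
  by_contra hne
  have h1 : insert x (insert y X) ⊆ T := by
    intro z hz
    rcases hz with rfl | rfl | hz
    · exact hx
    · exact hy
    · exact hX hz
  have h2 := Set.ncard_le_ncard h1 (Set.toFinite _)
  rw [Set.ncard_insert_of_notMem (by simp [hne, hx']) (Set.toFinite _),
    Set.ncard_insert_of_notMem hy' (Set.toFinite _)] at h2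
  omega

theorem subSums_subset_subgroup (f : ι → N) (P : Multiset ι) (H : AddSubgroup N)
    (h : ∀ p ∈ P, f p ∈ H) : subSums f P ⊆ (H : Set N) := by
  rintro s ⟨J, hJ, rfl⟩
  apply AddSubgroup.multiset_sum_mem
  intro x hx
  obtain ⟨p, hp, rfl⟩ := Multiset.mem_map.1 hx
  exact h p (Multiset.mem_of_le hJ hp)

open Classical in
/-- Structure lemma via the stabilizer of the set of subset sums modulo `κ`. -/
theorem stabilizer_split [Finite N] (k : ℕ) (hcard : Nat.card N = 2 * k) (κ : N) (hκ : κ ≠ 0)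
    (hκ2 : κ + κ = 0) (f : ι → N) (D : Multiset ι) (hD : k ≤ Multiset.card D + 1)
    (hz : ∀ J ≤ D, J ≠ 0 → (J.map f).sum ≠ 0)
    (x : N) (hx : ∀ J ≤ D, x + (J.map f).sum ≠ 0 ∧ x + (J.map f).sum ≠ κ) :
    ∃ (H : AddSubgroup N) (E F : Multiset ι), D = E + F ∧ κ ∈ H ∧ (∀ p ∈ E, f p ∈ H) ∧
      Multiset.card E + 1 = Nat.card H ∧ Multiset.card F + 2 = Nat.card (N ⧸ H) := by
  set X : Set N := {s | ∃ J ≤ D, s = (J.map f).sum ∨ s = (J.map f).sum + κ} with hXdef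
  let H : AddSubgroup N := 
    { carrier := {g | ∀ y ∈ X, g + y ∈ X}
      zero_mem' := by intro y hy; simpa using hy
      add_mem' := by
        intro a b ha hb y hy
        rw [add_assoc]
        exact ha _ (hb _ hy)
      neg_mem' := by
        intro a ha y hy
        obtain ⟨z, hz, rfl⟩ := neg_mem_of_stab X a ha y hy
        simpa using hz }
  have hH : ∀ g, g ∈ H ↔ ∀ y ∈ X, g + y ∈ X := fun g => Iff.rfl
  have hκH : κ ∈ H := by
    rw [hH]
    rintro y ⟨J, hJ, rfl | rfl⟩
    · exact ⟨J, hJ, Or.inr (by abel)⟩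
    · refine ⟨J, hJ, Or.inl ?_⟩
      rw [add_comm, add_assoc, hκ2, add_zero]
  let f' : ι → N ⧸ H := fun p => (f p : N ⧸ H)
  have hmap : ∀ J : Multiset ι, (J.map f').sum = (((J.map f).sum : N) : N ⧸ H) := by
    intro J
    have := (QuotientAddGroup.mk' H).map_multiset_sum (J.map f)
    rw [Multiset.map_map] at this
    exact this.symm
  have hmem : ∀ y : N, (y : N ⧸ H) ∈ subSums f' D ↔ y ∈ X := by
    intro y
    constructor
    · rintro ⟨J, hJ, h⟩
      rw [hmap, QuotientAddGroup.eq] at h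
      have := (hH _).1 h _ ⟨J, hJ, Or.inl rfl⟩
      simpa using this
    · rintro ⟨J, hJ, rfl | rfl⟩
      · exact ⟨J, hJ, hmap J⟩
      · refine ⟨J, hJ, ?_⟩
        rw [hmap, QuotientAddGroup.eq]
        simpa using hκH
  have haper : ∀ g, (∀ y ∈ subSums f' D, g + y ∈ subSums f' D) → g = 0 := by
    intro g hg
    induction g using QuotientAddGroup.induction_on with
    | H g =>
      rw [QuotientAddGroup.eq_zero_iff, hH]
      intro y hy
      have := hg _ ((hmem y).2 hy)
      rw [← QuotientAddGroup.mk_add] at this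
      exact (hmem _).1 this
  have hcF := card_le_of_aperiodic f' D haper
  have hlt : (subSums f' D).ncard < Nat.card (N ⧸ H) := by
    rw [← Set.ncard_univ]
    apply Set.ncard_lt_ncard _ (Set.toFinite _)
    refine ⟨Set.subset_univ _, fun h => ?_⟩
    obtain ⟨J, hJ, h | h⟩ := (hmem (-x)).1 (h (Set.mem_univ _))
    · apply (hx J hJ).1
      rw [← h]; simp
    · apply (hx J hJ).2
      have : (J.map f).sum = -x - κ := by rw [h]; abel
      rw [this]
      have h2 : κ = -κ := eq_neg_of_add_eq_zero_left hκ2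
      calc x + (-x - κ) = -κ := by abel
        _ = κ := h2.symm
  replace hcF : Multiset.card (D.filter (fun p => ¬ f p ∈ H)) + 1 ≤ (subSums f' D).ncard := by
    refine le_trans (le_of_eq ?_) hcF
    congr 2
    ext p
    simp only [Multiset.count_filter]
    simp [f', QuotientAddGroup.eq_zero_iff]
  have hEH : ∀ p ∈ D.filter (fun p => f p ∈ H), f p ∈ H := fun p hp => (Multiset.mem_filter.1 hp).2
  have hEF := Multiset.filter_add_not (fun p => f p ∈ H) D
  have hcE := card_le_of_zsf f (D.filter (fun p => f p ∈ H))
    (fun J hJ => hz J (hJ.trans (Multiset.filter_le _ _)))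
  have hcE2 : (subSums f (D.filter (fun p => f p ∈ H))).ncard ≤ Nat.card H := by
    have := Set.ncard_le_ncard (subSums_subset_subgroup f _ H hEH) (Set.toFinite _)
    exact this
  have hM : 2 ≤ Nat.card H := by
    have h1 : 1 < Nat.card H := by
      rw [Finite.one_lt_card_iff_nontrivial]
      exact ⟨⟨⟨κ, hκH⟩, 0, fun h => hκ (by simpa using congrArg Subtype.val h)⟩⟩
    exact h1
  have hMq := AddSubgroup.card_eq_card_quotient_mul_card_addSubgroup H
  have hcD := congrArg Multiset.card hEF
  rw [Multiset.card_add] at hcD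
  refine ⟨H, D.filter (fun p => f p ∈ H), D.filter (fun p => ¬ f p ∈ H), hEF.symm, hκH, hEH, ?_, ?_⟩
  · clear_value f' H
    generalize Multiset.card (D.filter (fun p => f p ∈ H)) = e at *
    generalize Multiset.card (D.filter (fun p => ¬ f p ∈ H)) = g at *
    generalize Nat.card H = M at *
    generalize Nat.card (N ⧸ H) = q at *
    have : 2 ≤ q := by omega
    nlinarith
  · clear_value f' H
    generalize Multiset.card (D.filter (fun p => f p ∈ H)) = e at *
    generalize Multiset.card (D.filter (fun p => ¬ f p ∈ H)) = g at *
    generalize Nat.card H = M at *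
    generalize Nat.card (N ⧸ H) = q at *
    have : 2 ≤ q := by omega
    nlinarith

/-- The difference of a pair. -/
def pdiff (p : N × N) : N := p.1 - p.2

theorem pairs_core [Finite N] (k : ℕ) (hcard : Nat.card N = 2 * k) (κ : N) (hκ : κ ≠ 0)
    (hκ2 : κ + κ = 0) (Adm : Multiset (N × N) → Prop)
    (hswap : ∀ a b a' b' P, Adm ((a, b) ::ₘ (a', b') ::ₘ P) → Adm ((a, b') ::ₘ (a', b) ::ₘ P))
    (M1 : ∀ P Q, Adm (P + Q) → P ≠ 0 → Q ≠ 0 → (P.map pdiff).sum ≠ 0)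
    (M2 : ∀ a b b' J K, Adm ((a, b) ::ₘ (a, b') ::ₘ (J + K)) →
      (a - b + (J.map pdiff).sum) + (a - b + (J.map pdiff).sum) ≠ 0)
    (M2' : ∀ a a' b J K, Adm ((a, b) ::ₘ (a', b) ::ₘ (J + K)) →
      (a - b + (J.map pdiff).sum) + (a - b + (J.map pdiff).sum) ≠ 0)
    (a b b' : N) (D : Multiset (N × N)) (hA : Adm ((a, b) ::ₘ (a, b') ::ₘ D))
    (hD : k ≤ Multiset.card D + 1) : False := by
  classical
  -- proper subfamilies of any admissible family are zero-sum free
  have hz : ∀ a b b' D, Adm ((a, b) ::ₘ (a, b') ::ₘ D) →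
      ∀ J ≤ D, J ≠ 0 → (J.map pdiff).sum ≠ 0 := by
    intro a b b' D hA J hJ hJ0
    obtain ⟨K, rfl⟩ := Multiset.le_iff_exists_add.1 hJ
    refine M1 J ((a, b) ::ₘ (a, b') ::ₘ K) ?_ hJ0 Multiset.cons_ne_zero
    simpa [Multiset.add_cons] using hA
  have hx : ∀ a b b' D, Adm ((a, b) ::ₘ (a, b') ::ₘ D) →
      ∀ J ≤ D, (a - b) + (J.map pdiff).sum ≠ 0 ∧ (a - b) + (J.map pdiff).sum ≠ κ := by
    intro a b b' D hA J hJ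
    obtain ⟨K, rfl⟩ := Multiset.le_iff_exists_add.1 hJ
    have := M2 a b b' J K hA
    constructor
    · intro h; rw [h] at this; simp at this
    · intro h; rw [h] at this; exact this hκ2
  obtain ⟨H, E, F, rfl, hκH, hEH, hcE, hcF⟩ := stabilizer_split k hcard κ hκ hκ2 pdiff D hD
    (hz a b b' D hA) (a - b) (hx a b b' D hA)
  have hzD := hz a b b' _ hA
  have hxD := hx a b b' _ hA
  have hM : 2 ≤ Nat.card H := by
    have h1 : 1 < Nat.card H := by
      rw [Finite.one_lt_card_iff_nontrivial]
      exact ⟨⟨⟨κ, hκH⟩, 0, fun h => hκ (by simpa using congrArg Subtype.val h)⟩⟩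
    exact h1
  obtain ⟨p3, hp3⟩ : ∃ p, p ∈ E := Multiset.card_pos_iff_exists_mem.1 (by omega)
  have hHnc : (H : Set N).ncard = Nat.card H := rfl
  have hEspan : subSums pdiff E = (H : Set N) := by
    apply Set.eq_of_subset_of_ncard_le (subSums_subset_subgroup _ _ H hEH) _ (Set.toFinite _)
    have := card_le_of_zsf pdiff E (fun J hJ => hzD J (hJ.trans (Multiset.le_add_right _ _)))
    omega
  obtain ⟨E0, rfl⟩ := Multiset.exists_cons_of_mem hp3
  obtain ⟨a3, b3⟩ := p3
  have hd3 : a3 - b3 ∈ H := hEH _ hp3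
  rw [Multiset.card_cons] at hcE
  have hE0le : E0 ≤ (a3, b3) ::ₘ E0 + F :=
    (Multiset.le_cons_self _ _).trans (Multiset.le_add_right _ _)
  have hE0sub : subSums pdiff E0 ⊆ (H : Set N) :=
    subSums_subset_subgroup _ _ H (fun p hp => hEH p (Multiset.mem_cons_of_mem hp))
  have hE0card : (H : Set N).ncard ≤ (subSums pdiff E0).ncard + 1 := by
    have := card_le_of_zsf pdiff E0 (fun J hJ => hzD J (hJ.trans hE0le))
    omega
  have hspan : ∀ z ∈ H, ∃ J ≤ E0, (J.map pdiff).sum = z ∨ (J.map pdiff).sum = z + κ := by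
    intro z hz
    by_contra! hcon
    have h1 : z ∉ subSums pdiff E0 := fun ⟨J, hJ, h⟩ => (hcon J hJ).1 h
    have h2 : z + κ ∉ subSums pdiff E0 := fun ⟨J, hJ, h⟩ => (hcon J hJ).2 h
    have := eq_of_missing _ _ hE0sub hE0card z (z + κ) hz (H.add_mem hz hκH) h1 h2
    exact hκ (by simpa using this)
  -- the quotient
  let f' : N × N → N ⧸ H := fun p => ((pdiff p : N) : N ⧸ H)
  have hmap : ∀ J : Multiset (N × N), (J.map f').sum = (((J.map pdiff).sum : N) : N ⧸ H) := by
    intro J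
    have := (QuotientAddGroup.mk' H).map_multiset_sum (J.map pdiff)
    rw [Multiset.map_map] at this
    exact this.symm
  have hFz : ∀ J ≤ F, J ≠ 0 → (J.map f').sum ≠ 0 := by
    intro J hJ hJ0 h
    rw [hmap, QuotientAddGroup.eq_zero_iff] at h
    have h2 : -(J.map pdiff).sum ∈ subSums pdiff ((a3, b3) ::ₘ E0) := by
      rw [hEspan]; exact H.neg_mem h
    obtain ⟨K, hK, hKs⟩ := h2
    refine hzD (K + J) (add_le_add hK hJ) ?_ ?_
    · intro h0
      exact hJ0 (by
        have := congrArg Multiset.card h0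
        rw [Multiset.card_add, Multiset.card_zero] at this
        exact Multiset.card_eq_zero.1 (by omega))
    · rw [Multiset.map_add, Multiset.sum_add, hKs]; simp
  have hFcard : (Set.univ : Set (N ⧸ H)).ncard ≤ (subSums f' F).ncard + 1 := by
    have := card_le_of_zsf f' F hFz
    rw [Set.ncard_univ]; omega
  have hmiss : ∀ x : N, (∀ J ≤ E0 + F, x + (J.map pdiff).sum ≠ 0 ∧ x + (J.map pdiff).sum ≠ κ) →
      ((-x : N) : N ⧸ H) ∉ subSums f' F := by
    rintro x hx ⟨J, hJ, h⟩
    rw [hmap, QuotientAddGroup.eq] at h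
    have h' : -(x + (J.map pdiff).sum) ∈ H := by
      have e : -(x + (J.map pdiff).sum) = -(J.map pdiff).sum + -x := by abel
      rw [e]; exact h
    obtain ⟨K, hK, h2⟩ := hspan _ h'
    have h3 := hx (K + J) (add_le_add hK hJ)
    rw [Multiset.map_add, Multiset.sum_add] at h3
    rcases h2 with h2 | h2
    · apply h3.1; rw [h2]; abel
    · apply h3.2; rw [h2]; abel
  -- the swapped pairing
  have hA' : Adm ((a, b3) ::ₘ (a, b') ::ₘ ((a3, b) ::ₘ (E0 + F))) := by
    have h1 : Adm ((a, b) ::ₘ (a3, b3) ::ₘ ((a, b') ::ₘ (E0 + F))) := by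
      rw [Multiset.cons_add, Multiset.cons_swap (a, b') (a3, b3)] at hA
      exact hA
    have h2 := hswap _ _ _ _ _ h1
    rwa [Multiset.cons_swap (a3, b) (a, b')] at h2
  have hzD' := hz _ _ _ _ hA'
  have hxD' := hx _ _ _ _ hA'
  have hq := eq_of_missing _ _ (Set.subset_univ _) hFcard _ _ (Set.mem_univ _) (Set.mem_univ _)
    (hmiss (a - b) (fun J hJ => hxD J (hJ.trans (by
      rw [Multiset.cons_add]; exact Multiset.le_cons_self _ _))))
    (hmiss (a - b3) (fun J hJ => hxD' J (hJ.trans (Multiset.le_cons_self _ _))))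
  rw [QuotientAddGroup.eq] at hq
  have hd3' : a3 - b ∈ H := by
    have e : a3 - b = (a3 - b3) + (- -(a - b) + -(a - b3)) := by abel
    rw [e]; exact H.add_mem hd3 hq
  have hnot : ∀ c, (∀ J ≤ (a3, c) ::ₘ E0, J ≠ 0 → (J.map pdiff).sum ≠ 0) →
      -(a3 - c) ∉ subSums pdiff E0 := by
    rintro c hc ⟨J, hJ, h⟩
    refine hc ((a3, c) ::ₘ J) ((Multiset.cons_le_cons_iff _).2 hJ) Multiset.cons_ne_zero ?_
    rw [Multiset.map_cons, Multiset.sum_cons, h]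
    simp [pdiff]
  have heq := eq_of_missing _ _ hE0sub hE0card _ _ (H.neg_mem hd3) (H.neg_mem hd3')
    (hnot b3 (fun J hJ => hzD J (hJ.trans (Multiset.le_add_right _ _))))
    (hnot b (fun J hJ => hzD' J (hJ.trans (by
      rw [← Multiset.cons_add]; exact Multiset.le_add_right _ _))))
  have hb : b3 = b := by simpa using heq
  subst hb
  obtain ⟨J, hJ, h⟩ := hspan _ (H.neg_mem hd3)
  obtain ⟨K, rfl⟩ := Multiset.le_iff_exists_add.1 hJ
  refine M2' a3 a b3 J (K + ((a, b') ::ₘ F)) ?_ ?_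
  · have e : ((a3, b3) ::ₘ (a, b3) ::ₘ (J + (K + (a, b') ::ₘ F)))
      = ((a, b3) ::ₘ (a, b') ::ₘ ((a3, b3) ::ₘ (J + K) + F)) := by
      simp only [← Multiset.singleton_add]; abel
    rw [e]; exact hA
  · rcases h with h | h
    · rw [h]; simp
    · rw [h]
      have e : a3 - b3 + (-(a3 - b3) + κ) = κ := by abel
      rw [e, hκ2]

end SubsetSums

section GroupPart

variable {N G : Type*} [AddCommGroup N] [Group G]

/-- The multiset of reflections attached to a multiset of pairs. -/
def refl2 (r : N → G) (P : Multiset (N × N)) : Multiset G :=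
  P.map (fun p => r p.1) + P.map (fun p => r p.2)

theorem refl2_add (r : N → G) (P Q : Multiset (N × N)) :
    refl2 r (P + Q) = refl2 r P + refl2 r Q := by
  simp only [refl2, Multiset.map_add]; abel

theorem refl2_cons (r : N → G) (a b : N) (P : Multiset (N × N)) :
    refl2 r ((a, b) ::ₘ P) = {r a} + {r b} + refl2 r P := by
  simp only [refl2, Multiset.map_cons]
  simp only [← Multiset.singleton_add]; abel

theorem refl2_swap (r : N → G) (P : Multiset (N × N)) :
    refl2 r (P.map Prod.swap) = refl2 r P := by
  simp only [refl2, Multiset.map_map, Function.comp_def, Prod.fst_swap, Prod.snd_swap]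
  exact add_comm _ _

theorem sum_pdiff_swap (P : Multiset (N × N)) :
    ((P.map Prod.swap).map pdiff).sum = -(P.map pdiff).sum := by
  induction P using Multiset.induction with
  | empty => simp
  | cons p P ih =>
    simp only [Multiset.map_cons, Multiset.sum_cons, ih, pdiff, Prod.fst_swap, Prod.snd_swap]
    abel

theorem exists_list_rot (ρ : N → G) (h0 : ρ 0 = 1) (h1 : ∀ u v, ρ u * ρ v = ρ (u + v))
    (U : Multiset N) : ∃ l : List G, (l : Multiset G) = U.map ρ ∧ l.prod = ρ U.sum := by
  induction U using Multiset.induction with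
  | empty => exact ⟨[], by simp, by simp [h0]⟩
  | cons u U ih =>
    obtain ⟨l, hl, hp⟩ := ih
    exact ⟨ρ u :: l, by simp [← hl], by simp [hp, h1]⟩

theorem exists_list_refl (ρ r : N → G) (h0 : ρ 0 = 1) (h1 : ∀ u v, ρ u * ρ v = ρ (u + v))
    (h4 : ∀ a b, r a * r b = ρ (a - b))
    (P : Multiset (N × N)) :
    ∃ l : List G, (l : Multiset G) = refl2 r P ∧ l.prod = ρ (P.map pdiff).sum := by
  induction P using Multiset.induction with
  | empty => exact ⟨[], by simp [refl2], by simp [h0]⟩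
  | cons p P ih =>
    obtain ⟨l, hl, hp⟩ := ih
    obtain ⟨a, b⟩ := p
    refine ⟨r a :: r b :: l, ?_, ?_⟩
    · rw [refl2_cons, ← hl, ← Multiset.cons_coe, ← Multiset.cons_coe]
      simp only [← Multiset.singleton_add]; abel
    · rw [List.prod_cons, List.prod_cons, ← mul_assoc, h4, hp, h1]
      simp [pdiff]

theorem productOne_refl_rot (ρ r : N → G) (h0 : ρ 0 = 1) (h1 : ∀ u v, ρ u * ρ v = ρ (u + v))
    (h2 : ∀ u a, ρ u * r a = r (u + a)) (h3 : ∀ a u, r a * ρ u = r (a - u))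
    (h4 : ∀ a b, r a * r b = ρ (a - b))
    (P : Multiset (N × N)) (U V : Multiset N) (hP : P ≠ 0)
    (hs : (P.map pdiff).sum + U.sum - V.sum = 0) :
    IsProductOne (refl2 r P + U.map ρ + V.map ρ) := by
  obtain ⟨p, hp⟩ := Multiset.exists_mem_of_ne_zero hP
  obtain ⟨P', rfl⟩ := Multiset.exists_cons_of_mem hp
  obtain ⟨a, b⟩ := p
  obtain ⟨lu, hlu, hpu⟩ := exists_list_rot ρ h0 h1 U
  obtain ⟨lv, hlv, hpv⟩ := exists_list_rot ρ h0 h1 V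
  obtain ⟨lp, hlp, hpp⟩ := exists_list_refl ρ r h0 h1 h4 P'
  refine ⟨lu ++ ([r a] ++ (lv ++ ([r b] ++ lp))), ?_, ?_⟩
  · rw [refl2_cons, ← hlu, ← hlv, ← hlp]
    simp only [← Multiset.coe_add, Multiset.coe_singleton]
    abel
  · simp only [List.prod_append, List.prod_singleton, hpu, hpv, hpp]
    rw [h3, h2, h4, h1, ← h0]
    congr 1
    rw [← hs]
    simp only [Multiset.map_cons, Multiset.sum_cons, pdiff]
    abel

theorem signed_split (ρ r : N → G) (h0 : ρ 0 = 1) (h1 : ∀ u v, ρ u * ρ v = ρ (u + v))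
    (h2 : ∀ u a, ρ u * r a = r (u + a)) (h3 : ∀ a u, r a * ρ u = r (a - u))
    (h4 : ∀ a b, r a * r b = ρ (a - b)) (l : List G) (hl : ∀ g ∈ l, (∃ v, ρ v = g) ∨ ∃ a, r a = g) :
    ∃ A B U V : Multiset N, (l : Multiset G) = A.map r + B.map r + U.map ρ + V.map ρ ∧
      ((Multiset.card A = Multiset.card B ∧ l.prod = ρ (A.sum - B.sum + U.sum - V.sum)) ∨
       (Multiset.card A = Multiset.card B + 1 ∧ l.prod = r (A.sum - B.sum + U.sum - V.sum))) := by
  induction l with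
  | nil => exact ⟨0, 0, 0, 0, by simp, Or.inl ⟨rfl, by simp [h0]⟩⟩
  | cons g l ih =>
    obtain ⟨A, B, U, V, hm, hp⟩ := ih (fun g hg => hl g (List.mem_cons_of_mem _ hg))
    rcases hl g List.mem_cons_self with ⟨v, rfl⟩ | ⟨a, rfl⟩
    · refine ⟨A, B, v ::ₘ U, V, ?_, ?_⟩
      · rw [← Multiset.cons_coe, hm]
        simp only [Multiset.map_cons]
        simp only [← Multiset.singleton_add]; abel
      · rcases hp with ⟨hc, hp⟩ | ⟨hc, hp⟩
        · refine Or.inl ⟨hc, ?_⟩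
          rw [List.prod_cons, hp, h1, Multiset.sum_cons]
          congr 1; abel
        · refine Or.inr ⟨hc, ?_⟩
          rw [List.prod_cons, hp, h2, Multiset.sum_cons]
          congr 1; abel
    · refine ⟨a ::ₘ B, A, V, U, ?_, ?_⟩
      · rw [← Multiset.cons_coe, hm]
        simp only [Multiset.map_cons]
        simp only [← Multiset.singleton_add]; abel
      · rcases hp with ⟨hc, hp⟩ | ⟨hc, hp⟩
        · refine Or.inr ⟨by rw [Multiset.card_cons, hc], ?_⟩
          rw [List.prod_cons, hp, h3, Multiset.sum_cons]
          congr 1; abel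
        · refine Or.inl ⟨by rw [Multiset.card_cons, hc], ?_⟩
          rw [List.prod_cons, hp, h4, Multiset.sum_cons]
          congr 1; abel

theorem exists_pairs (A B : Multiset N) (h : Multiset.card A = Multiset.card B) :
    ∃ P : Multiset (N × N), P.map Prod.fst = A ∧ P.map Prod.snd = B := by
  induction A using Quotient.inductionOn with
  | h la =>
  induction B using Quotient.inductionOn with
  | h lb =>
    have h' : la.length = lb.length := h
    refine ⟨(la.zip lb : List (N × N)), ?_, ?_⟩
    · simp [List.map_fst_zip h'.le]
    · simp [List.map_snd_zip h'.ge]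

theorem exists_two {α β : Type*} (f : α → β) (P : Multiset α) (h : ¬ (P.map f).Nodup) :
    ∃ p q D, P = p ::ₘ q ::ₘ D ∧ f p = f q := by
  classical
  rw [Multiset.nodup_iff_ne_cons_cons] at h
  push Not at h
  obtain ⟨x, t, hx⟩ := h
  obtain ⟨p, hp, hfp, hr⟩ := (Multiset.map_eq_cons f P _ _).2 hx
  obtain ⟨q, hq, hfq, -⟩ := (Multiset.map_eq_cons f _ _ _).2 hr
  refine ⟨p, q, (P.erase p).erase q, ?_, hfp.trans hfq.symm⟩
  rw [Multiset.cons_erase hq, Multiset.cons_erase hp]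

theorem pairs_part [Finite N] (k : ℕ) (hcard : Nat.card N = 2 * k) (κ : N) (hκ : κ ≠ 0)
    (hκ2 : κ + κ = 0) (Adm : Multiset (N × N) → Prop)
    (hswap : ∀ a b a' b' P, Adm ((a, b) ::ₘ (a', b') ::ₘ P) → Adm ((a, b') ::ₘ (a', b) ::ₘ P))
    (M1 : ∀ P Q, Adm (P + Q) → P ≠ 0 → Q ≠ 0 → (P.map pdiff).sum ≠ 0)
    (M2 : ∀ a b b' J K, Adm ((a, b) ::ₘ (a, b') ::ₘ (J + K)) →
      (a - b + (J.map pdiff).sum) + (a - b + (J.map pdiff).sum) ≠ 0)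
    (M2' : ∀ a a' b J K, Adm ((a, b) ::ₘ (a', b) ::ₘ (J + K)) →
      (a - b + (J.map pdiff).sum) + (a - b + (J.map pdiff).sum) ≠ 0)
    (P : Multiset (N × N)) (hA : Adm P)
    (hP : k + 1 ≤ Multiset.card P) : False := by
  classical
  have hk : 0 < k := by
    have : 0 < Nat.card N := Nat.card_pos
    omega
  by_cases hfst : (P.map Prod.fst).Nodup
  · by_cases hsnd : (P.map Prod.snd).Nodup
    · have hdis : Disjoint (P.map Prod.fst) (P.map Prod.snd) := by
        rw [Multiset.disjoint_left]
        intro x hx hx'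
        obtain ⟨p, hp, hpx⟩ := Multiset.mem_map.1 hx
        obtain ⟨q, hq, hqx⟩ := Multiset.mem_map.1 hx'
        obtain ⟨D, rfl⟩ := Multiset.exists_cons_of_mem hp
        rcases Multiset.mem_cons.1 hq with rfl | hq
        · refine M1 {q} D (by simpa using hA) (by simp) ?_ ?_
          · rintro rfl
            simp at hP
            omega
          · simp [pdiff, hpx, hqx]
        · obtain ⟨D, rfl⟩ := Multiset.exists_cons_of_mem hq
          obtain ⟨a, b⟩ := p
          obtain ⟨a', b'⟩ := q
          simp only at hpx hqx
          subst hpx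
          subst hqx
          have := hswap _ _ _ _ _ hA
          refine M1 {(b', b')} ((a', b) ::ₘ D) (by simpa only [Multiset.singleton_add] using this) (by simp) Multiset.cons_ne_zero ?_
          simp [pdiff]
      have hnd : (P.map Prod.fst + P.map Prod.snd).Nodup :=
        Multiset.nodup_add.2 ⟨hfst, hsnd, hdis⟩
      have : Fintype N := Fintype.ofFinite N
      have hle := Finset.card_le_univ (⟨_, hnd⟩ : Finset N)
      rw [← Nat.card_eq_fintype_card, hcard] at hle
      simp at hle
      omega
    · obtain ⟨⟨a, b⟩, ⟨a', b'⟩, D, rfl, h⟩ := exists_two _ _ hsnd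
      simp only at h
      subst h
      refine pairs_core k hcard κ hκ hκ2 (fun P => Adm (P.map Prod.swap)) ?_ ?_ ?_ ?_ b a a'
        (D.map Prod.swap) ?_ ?_
      · intro a b a' b' P h
        simp only [Multiset.map_cons, Prod.swap_prod_mk] at h ⊢
        rw [Multiset.cons_swap]
        exact hswap _ _ _ _ _ h
      · intro P Q h hP hQ h0
        rw [Multiset.map_add] at h
        refine M1 _ _ h (by simpa using hP) (by simpa using hQ) ?_
        rw [sum_pdiff_swap, h0, neg_zero]
      · intro a b b' J K h h0
        simp only [Multiset.map_cons, Prod.swap_prod_mk, Multiset.map_add] at h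
        refine M2' _ _ _ _ _ h ?_
        rw [sum_pdiff_swap, ← neg_eq_zero, ← h0]
        abel
      · intro a a' b J K h h0
        simp only [Multiset.map_cons, Prod.swap_prod_mk, Multiset.map_add] at h
        refine M2 _ _ _ _ _ h ?_
        rw [sum_pdiff_swap, ← neg_eq_zero, ← h0]
        abel
      · simpa [Multiset.map_map, Function.comp_def] using hA
      · simp at hP ⊢; omega
  · obtain ⟨⟨a, b⟩, ⟨a', b'⟩, D, rfl, h⟩ := exists_two _ _ hfst
    simp only at h
    subst h
    exact pairs_core k hcard κ hκ hκ2 Adm hswap M1 M2 M2' a b b' D hA (by simp at hP; omega)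

theorem group_part [Finite N] (k : ℕ) (hcard : Nat.card N = 2 * k) (κ : N) (hκ : κ ≠ 0)
    (hκ2 : κ + κ = 0) (ρ r : N → G) (h0 : ρ 0 = 1) (h1 : ∀ u v, ρ u * ρ v = ρ (u + v))
    (h2 : ∀ u a, ρ u * r a = r (u + a)) (h3 : ∀ a u, r a * ρ u = r (a - u))
    (h4 : ∀ a b, r a * r b = ρ (a - b)) (hinj : ∀ v, ρ v = 1 → v = 0)
    (hr : ∀ a v, r a ≠ ρ v) (S₁ S₂ : Multiset G) (hS : IsMinimalProductOne (S₁ + S₂))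
    (hS1 : ∀ g ∈ S₁, ∃ v, ρ v = g) (hS2 : ∀ g ∈ S₂, ∃ a, r a = g)
    (hc : 2 * k + 2 ≤ Multiset.card S₂) : False := by
  classical
  obtain ⟨-, ⟨l, hl, hprod⟩, hmin⟩ := hS
  obtain ⟨A, B, U, V, hm, hp⟩ := signed_split ρ r h0 h1 h2 h3 h4 l (by
    intro g hg
    have : g ∈ (l : Multiset G) := hg
    rw [hl, Multiset.mem_add] at this
    exact this.imp (hS1 g) (hS2 g))
  rw [hprod] at hp
  rcases hp with ⟨hcAB, hs⟩ | ⟨-, hs⟩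
  swap
  · exact hr _ 0 (by rw [← hs, h0])
  have hs0 := hinj _ hs.symm
  rw [hl] at hm
  have hcount : Multiset.card S₂ = Multiset.card A + Multiset.card B := by
    have := congrArg (Multiset.countP (fun g => ∃ a, r a = g)) hm
    simp only [Multiset.countP_add] at this
    rw [Multiset.countP_eq_zero.2, Multiset.countP_eq_card.2 hS2,
      Multiset.countP_eq_card.2, Multiset.countP_eq_card.2, Multiset.countP_eq_zero.2,
      Multiset.countP_eq_zero.2] at this
    · simpa using this
    · intro g hg ⟨a, ha⟩
      obtain ⟨v, -, hv⟩ := Multiset.mem_map.1 hg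
      exact hr a v (ha.trans hv.symm)
    · intro g hg ⟨a, ha⟩
      obtain ⟨v, -, hv⟩ := Multiset.mem_map.1 hg
      exact hr a v (ha.trans hv.symm)
    · intro g hg
      obtain ⟨v, -, hv⟩ := Multiset.mem_map.1 hg
      exact ⟨v, hv⟩
    · intro g hg
      obtain ⟨v, -, hv⟩ := Multiset.mem_map.1 hg
      exact ⟨v, hv⟩
    · intro g hg ⟨a, ha⟩
      obtain ⟨v, hv⟩ := hS1 g hg
      exact hr a v (ha.trans hv.symm)
  obtain ⟨P, rfl, rfl⟩ := exists_pairs A B hcAB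
  have hsum : ∀ Q : Multiset (N × N),
      (Q.map Prod.fst).sum - (Q.map Prod.snd).sum = (Q.map pdiff).sum := by
    intro Q
    induction Q using Multiset.induction with
    | empty => simp
    | cons p Q ih => simp only [Multiset.map_cons, Multiset.sum_cons, ← ih, pdiff]; abel
  have hne : ∀ Q : Multiset (N × N), Q ≠ 0 → refl2 r Q ≠ 0 := by
    intro Q hQ h
    apply hQ
    have := congrArg Multiset.card h
    simp only [refl2, Multiset.card_add, Multiset.card_map, Multiset.card_zero] at this
    exact Multiset.card_eq_zero.1 (by omega)
  have key : ∀ Q R : Multiset (N × N), Q ≠ 0 → R ≠ 0 → (Q.map pdiff).sum = 0 →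
      (R.map pdiff).sum + U.sum - V.sum = 0 →
      S₁ + S₂ ≠ refl2 r Q + (refl2 r R + U.map ρ + V.map ρ) := by
    intro Q R hQ hR hQs hRs
    refine hmin _ _ (hne Q hQ) ?_ ?_ (productOne_refl_rot ρ r h0 h1 h2 h3 h4 R U V hR hRs)
    · intro h
      rw [add_assoc] at h
      exact hne R hR (add_eq_zero.1 h).1
    · have := productOne_refl_rot ρ r h0 h1 h2 h3 h4 Q 0 0 hQ (by simpa using hQs)
      simpa using this
  refine pairs_part k hcard κ hκ hκ2 (fun P => S₁ + S₂ = refl2 r P + U.map ρ + V.map ρ ∧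
    (P.map pdiff).sum + U.sum - V.sum = 0) ?_ ?_ ?_ ?_ P ⟨?_, ?_⟩ ?_
  · rintro a b a' b' P ⟨h, h'⟩
    refine ⟨?_, ?_⟩
    · rw [h]; simp only [refl2_cons]; abel
    · rw [← h']; simp only [Multiset.map_cons, Multiset.sum_cons, pdiff]; abel
  · rintro P Q ⟨h, h'⟩ hP hQ hPs
    refine key P Q hP hQ hPs ?_ ?_
    · rw [← h', Multiset.map_add, Multiset.sum_add, hPs, zero_add]
    · rw [h, refl2_add]; abel
  · rintro a b b' J K ⟨h, h'⟩ hd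
    refine key {(a, a)} ((b, b') ::ₘ (J.map Prod.swap + K)) (by simp) Multiset.cons_ne_zero
      (by simp [pdiff]) ?_ ?_
    · have e := congrArg₂ (· - ·) h' hd
      simp only [Multiset.map_cons, Multiset.sum_cons, Multiset.map_add, Multiset.sum_add,
        sum_pdiff_swap, pdiff, sub_zero] at e ⊢
      rw [← e]; abel
    · rw [h, ← Multiset.cons_zero]
      simp only [refl2_cons, refl2_add, refl2_swap]
      simp only [refl2, Multiset.map_zero]; abel
  · rintro a a' b J K ⟨h, h'⟩ hd
    refine key {(b, b)} ((a', a) ::ₘ (J.map Prod.swap + K)) (by simp) Multiset.cons_ne_zero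
      (by simp [pdiff]) ?_ ?_
    · have e := congrArg₂ (· - ·) h' hd
      simp only [Multiset.map_cons, Multiset.sum_cons, Multiset.map_add, Multiset.sum_add,
        sum_pdiff_swap, pdiff, sub_zero] at e ⊢
      rw [← e]; abel
    · rw [h, ← Multiset.cons_zero]
      simp only [refl2_cons, refl2_add, refl2_swap]
      simp only [refl2, Multiset.map_zero]; abel
  · rw [hm]; simp [refl2, Multiset.map_map, Function.comp_def]
  · rw [← hs0, hsum]
  · simp only [Multiset.card_map] at hcount
    omega

end GroupPart

theorem no_minimal_product_one_with_long_reflection_part_dihedral_even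
    (n : ℕ) (hn : 4 ≤ n) (heven : Even n)
    (G : Type*) [Group G] (α τ : G) (hcardG : Nat.card G = 2 * n)
    (hgen : Subgroup.closure {α, τ} = ⊤) (hα : α ^ n = 1) (hτ : τ ^ 2 = 1)
    (hrel : τ * α = α⁻¹ * τ) :
    ¬ ∃ S₁ S₂ : Multiset G,
        IsMinimalProductOne (S₁ + S₂) ∧
        (∀ g ∈ S₁, g ∈ Subgroup.zpowers α) ∧
        (∀ g ∈ S₂, g ∉ Subgroup.zpowers α) ∧
        n + 2 ≤ Multiset.card S₂ := by
  rintro ⟨S₁, S₂, hS, hS1, hS2, hc⟩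
  obtain ⟨k, hk⟩ := heven
  have : NeZero n := ⟨by omega⟩
  let φ : ZMod n →+ Additive G := ZMod.lift n ⟨zmultiplesHom (Additive G) (Additive.ofMul α), by
    have : (n : ℤ) • Additive.ofMul α = 0 := by
      rw [natCast_zsmul, ← ofMul_pow, hα]; rfl
    simpa using this⟩
  let ρ : ZMod n → G := fun v => (φ v).toMul
  let r : ZMod n → G := fun v => ρ v * τ
  have hρz : ∀ z : ℤ, ρ (z : ZMod n) = α ^ z := by
    intro z
    simp [ρ, φ, ZMod.lift_coe]
  have h0 : ρ 0 = 1 := by simp [ρ]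
  have h1 : ∀ u v, ρ u * ρ v = ρ (u + v) := by intro u v; simp [ρ]
  have hττ : τ * τ = 1 := by rw [← sq, hτ]
  have hτρ : ∀ v, τ * ρ v = ρ (-v) * τ := by
    intro v
    obtain ⟨z, rfl⟩ := ZMod.intCast_surjective v
    rw [← Int.cast_neg, hρz, hρz]
    have hs : SemiconjBy τ α α⁻¹ := hrel
    have := (hs.zpow_right z).eq
    rw [this, inv_zpow', ]
  have h2 : ∀ u a, ρ u * r a = r (u + a) := by
    intro u a; simp only [r]; rw [← mul_assoc, h1]
  have h3 : ∀ a u, r a * ρ u = r (a - u) := by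
    intro a u; simp only [r]; rw [mul_assoc, hτρ, ← mul_assoc, h1, sub_eq_add_neg]
  have h4 : ∀ a b, r a * r b = ρ (a - b) := by
    intro a b
    have : r b = ρ b * τ := rfl
    rw [this, ← mul_assoc, h3]
    simp only [r]
    rw [mul_assoc, hττ, mul_one]
  have hsurj : Function.Surjective (Sum.elim ρ r) := by
    let K : Subgroup G :=
      { carrier := {g | (∃ v, ρ v = g) ∨ ∃ a, r a = g}
        one_mem' := Or.inl ⟨0, h0⟩
        mul_mem' := by
          rintro _ _ (⟨u, rfl⟩ | ⟨a, rfl⟩) (⟨v, rfl⟩ | ⟨b, rfl⟩)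
          · exact Or.inl ⟨_, (h1 u v).symm⟩
          · exact Or.inr ⟨_, (h2 u b).symm⟩
          · exact Or.inr ⟨_, (h3 a v).symm⟩
          · exact Or.inl ⟨_, (h4 a b).symm⟩
        inv_mem' := by
          rintro _ (⟨u, rfl⟩ | ⟨a, rfl⟩)
          · exact Or.inl ⟨-u, by rw [eq_comm, inv_eq_iff_mul_eq_one, h1]; simp [h0]⟩
          · exact Or.inr ⟨a, by rw [eq_comm, inv_eq_iff_mul_eq_one, h4]; simp [h0]⟩ }
    have hle : Subgroup.closure {α, τ} ≤ K := by
      rw [Subgroup.closure_le]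
      rintro g (rfl | rfl)
      · exact Or.inl ⟨((1 : ℤ) : ZMod n), by rw [hρz, zpow_one]⟩
      · exact Or.inr ⟨0, by simp [r, h0]⟩
    intro g
    have : g ∈ K := hle (by rw [hgen]; trivial)
    rcases this with ⟨v, hv⟩ | ⟨a, ha⟩
    · exact ⟨Sum.inl v, hv⟩
    · exact ⟨Sum.inr a, ha⟩
  have : Finite G := Nat.finite_of_card_ne_zero (by omega)
  have hbij : Function.Bijective (Sum.elim ρ r) := by
    rw [Nat.bijective_iff_surjective_and_card]
    refine ⟨hsurj, ?_⟩
    rw [Nat.card_sum, Nat.card_zmod, hcardG]; omega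
  have hinj : ∀ v, ρ v = 1 → v = 0 := by
    intro v hv
    have := hbij.1 (a₁ := Sum.inl v) (a₂ := Sum.inl 0) (by simp [hv, h0])
    simpa using this
  have hr : ∀ a v, r a ≠ ρ v := by
    intro a v h
    have := hbij.1 (a₁ := Sum.inr a) (a₂ := Sum.inl v) (by simpa using h)
    simp at this
  refine group_part k (by rw [Nat.card_zmod]; omega) (k : ZMod n) ?_ ?_ ρ r h0 h1 h2 h3 h4 hinj hr
    S₁ S₂ hS ?_ ?_ (by omega)
  · rw [Ne, ZMod.natCast_eq_zero_iff]
    intro h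
    have := Nat.le_of_dvd (by omega) h
    omega
  · rw [← Nat.cast_add, ← hk, ZMod.natCast_self]
  · intro g hg
    obtain ⟨z, hz⟩ := hS1 g hg
    exact ⟨z, by rw [hρz]; exact hz⟩
  · intro g hg
    obtain ⟨v | a, hv⟩ := hsurj g
    · exfalso
      obtain ⟨z, rfl⟩ := ZMod.intCast_surjective v
      refine hS2 g hg ⟨z, ?_⟩
      rw [← hv]
      simp [hρz]
    · exact ⟨a, hv⟩
end

section
/- Let n ≥ 2 and let G = ⟨α, τ | α^{2n} = 1_G, τ^2 = α^n, τα = α^{-1}τ⟩ be a dicyclic group of order 4n. Let S be a minimal product-one sequence over G such that |S| ≥ 2n + 2 and every term of S lies in G \ ⟨α⟩. Then |S| = 2n + 2 and S = (α^x τ)^{[n+2]} · S_0, where x ∈ [0, 2n-1] and S_0 is a sequence of length n having one of the following two forms: (a) S_0 = (α^y τ)^{[2]} · (α^{y+n} τ) · (α^{y_1} τ) · … · (α^{y_{n-3}} τ), where n ≥ 3, y, y_1, …, y_{n-3} ∈ [0, 2n-1] are such that 2y ≢ 2x (mod 2n), 2y_i ≢ 2x (mod 2n) for all i ∈ [1,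 n-3], and (y_1 + … + y_{n-3}) + 3y + n + x ≡ (n+1)(x + n) (mod 2n); (b) S_0 = (α^y τ)^{[n]}, where y ∈ [0, 2n-1] is such that 2y ≢ 2x (mod 2n) and ny + x ≡ (n+1)(x + n) (mod 2n). -/
open Finset in
/-- Nonempty subset sums. -/
def nsums {ι M : Type*} [DecidableEq ι] [AddCommGroup M] [DecidableEq M] (f : ι → M)
    (I : Finset ι) : Finset M :=
  (I.powerset.filter (fun J => J.Nonempty)).image (fun J => ∑ i ∈ J, f i)

theorem mem_nsums {ι M : Type*} [DecidableEq ι] [AddCommGroup M] [DecidableEq M] {f : ι → M}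
    {I : Finset ι} {x : M} :
    x ∈ nsums f I ↔ ∃ J, J ⊆ I ∧ J.Nonempty ∧ ∑ i ∈ J, f i = x := by
  simp [nsums, and_assoc]

theorem nsums_card {ι M : Type*} [DecidableEq ι] [AddCommGroup M] [DecidableEq M] (f : ι → M)
    (J K : Finset ι) (hd : Disjoint J K)
    (h : ∀ L ⊆ J ∪ K, L.Nonempty → ∑ i ∈ L, f i ≠ 0) :
    (nsums f J).card + K.card ≤ (nsums f (J ∪ K)).card := by
  induction K using Finset.induction_on with
  | empty => simp
  | insert a K ha ih =>
    have hd' : Disjoint J K := Finset.disjoint_of_subset_right (Finset.subset_insert a K) hd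
    have haJ : a ∉ J := fun h => (Finset.disjoint_left.1 hd h) (Finset.mem_insert_self a K)
    have haJK : a ∉ J ∪ K := by simp [ha, haJ]
    have hsub : J ∪ K ⊆ J ∪ insert a K :=
      Finset.union_subset_union_right (Finset.subset_insert a K)
    have h1 := ih hd' (fun L hL => h L (hL.trans hsub))
    have hins : J ∪ insert a K = insert a (J ∪ K) := Finset.union_insert a J K
    have hnot : ∑ i ∈ insert a (J ∪ K), f i ∉ nsums f (J ∪ K) := by
      intro hm
      obtain ⟨L, hL, hne, hs⟩ := mem_nsums.1 hm
      have hL' : L ⊆ insert a (J ∪ K) := hL.trans (Finset.subset_insert _ _)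
      have := Finset.sum_sdiff (f := f) hL'
      refine h (insert a (J ∪ K) \ L) ?_ ⟨a, ?_⟩ ?_
      · rw [hins]; exact Finset.sdiff_subset
      · simp only [Finset.mem_sdiff, Finset.mem_insert_self, true_and]
        exact fun hh => haJK (hL hh)
      · rw [hs] at this; simpa using this
    have hss : insert (∑ i ∈ insert a (J ∪ K), f i) (nsums f (J ∪ K)) ⊆
        nsums f (J ∪ insert a K) := by
      intro x hx
      rcases Finset.mem_insert.1 hx with rfl | hx
      · exact mem_nsums.2 ⟨insert a (J ∪ K), hins.ge, ⟨a, Finset.mem_insert_self _ _⟩, rfl⟩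
      · obtain ⟨L, hL, hne, hs⟩ := mem_nsums.1 hx
        exact mem_nsums.2 ⟨L, hL.trans hsub, hne, hs⟩
    have := Finset.card_le_card hss
    rw [Finset.card_insert_of_notMem hnot] at this
    rw [Finset.card_insert_of_notMem ha]
    omega

theorem nsums_card' {ι M : Type*} [DecidableEq ι] [AddCommGroup M] [DecidableEq M] (f : ι → M)
    (K : Finset ι)
    (h : ∀ L ⊆ K, L.Nonempty → ∑ i ∈ L, f i ≠ 0) :
    K.card ≤ (nsums f K).card := by
  have := nsums_card f ∅ K (by simp) (by simpa using h)
  simp only [Finset.empty_union] at this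
  omega

/-- Nonempty proper subset sums. -/
def psums {ι M : Type*} [DecidableEq ι] [AddCommGroup M] [DecidableEq M] (f : ι → M)
    (I : Finset ι) : Finset M :=
  (I.powerset.filter (fun J => J.Nonempty ∧ J ≠ I)).image (fun J => ∑ i ∈ J, f i)

theorem mem_psums {ι M : Type*} [DecidableEq ι] [AddCommGroup M] [DecidableEq M] {f : ι → M}
    {I : Finset ι} {x : M} :
    x ∈ psums f I ↔ ∃ J, J ⊆ I ∧ J.Nonempty ∧ J ≠ I ∧ ∑ i ∈ J, f i = x := by
  simp [psums, and_assoc]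

theorem nsums_erase_subset {ι M : Type*} [DecidableEq ι] [AddCommGroup M] [DecidableEq M]
    (f : ι → M) (I : Finset ι) (u : ι) (hu : u ∈ I) : nsums f (I.erase u) ⊆ psums f I := by
  intro x hx
  obtain ⟨L, hL, hne, hs⟩ := mem_nsums.1 hx
  refine mem_psums.2 ⟨L, hL.trans (Finset.erase_subset _ _), hne, ?_, hs⟩
  rintro rfl
  simpa using hL hu

theorem psums_card {ι M : Type*} [DecidableEq ι] [AddCommGroup M] [DecidableEq M]
    (f : ι → M) (I : Finset ι) (hI : I.Nonempty)
    (h : ∀ L ⊆ I, L.Nonempty → L ≠ I → ∑ i ∈ L, f i ≠ 0) :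
    I.card ≤ (psums f I).card + 1 := by
  obtain ⟨u, hu⟩ := hI
  have h1 := Finset.card_le_card (nsums_erase_subset f I u hu)
  have h2 := nsums_card' f (I.erase u) (fun L hL hne => h L (hL.trans (Finset.erase_subset _ _)) hne
    (by rintro rfl; simpa using hL hu))
  rw [Finset.card_erase_of_mem hu] at h2
  omega

theorem psums_card_of_ne {ι M : Type*} [DecidableEq ι] [AddCommGroup M] [DecidableEq M]
    (f : ι → M) (I : Finset ι) 
    (h : ∀ L ⊆ I, L.Nonempty → L ≠ I → ∑ i ∈ L, f i ≠ 0) (i j : ι) (hi : i ∈ I) (hj : j ∈ I)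
    (hij : f i ≠ f j) :
    I.card ≤ (psums f I).card := by
  have hne : i ≠ j := by rintro rfl; exact hij rfl
  by_cases hc : I = {i, j}
  · have : ({f i, f j} : Finset M) ⊆ psums f I := by
      intro x hx
      simp only [Finset.mem_insert, Finset.mem_singleton] at hx
      rcases hx with rfl | rfl
      · refine mem_psums.2 ⟨{i}, by simpa using hi, by simp, ?_, by simp⟩
        rintro rfl
        exact hne (Finset.mem_singleton.1 hj).symm
      · refine mem_psums.2 ⟨{j}, by simpa using hj, by simp, ?_, by simp⟩
        rintro rfl
        exact hne (Finset.mem_singleton.1 hi)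
    have := Finset.card_le_card this
    rw [Finset.card_pair hij] at this
    rw [hc, Finset.card_pair hne, ← hc]
    exact this
  · have hsub : ({i, j} : Finset ι) ⊆ I := by
      intro x hx
      simp only [Finset.mem_insert, Finset.mem_singleton] at hx
      rcases hx with rfl | rfl <;> assumption
    obtain ⟨u, hu, hu'⟩ := Finset.exists_of_ssubset (Finset.ssubset_iff_subset_ne.2 ⟨hsub, Ne.symm hc⟩)
    have hsub2 : ({i, j} : Finset ι) ⊆ I.erase u := fun x hx =>
      Finset.mem_erase.2 ⟨by rintro rfl; exact hu' hx, hsub hx⟩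
    have h1 := Finset.card_le_card (nsums_erase_subset f I u hu)
    have hfree : ∀ L ⊆ I.erase u, L.Nonempty → ∑ i ∈ L, f i ≠ 0 := fun L hL hne =>
      h L (hL.trans (Finset.erase_subset _ _)) hne (by rintro rfl; simpa using hL hu)
    have h2 := nsums_card f {i, j} ((I.erase u) \ {i, j}) Finset.disjoint_sdiff
      (by rw [Finset.union_sdiff_of_subset hsub2]; exact hfree)
    rw [Finset.union_sdiff_of_subset hsub2, Finset.card_sdiff_of_subset hsub2,
      Finset.card_pair hne, Finset.card_erase_of_mem hu] at h2
    have h4 : 3 ≤ I.card := by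
      have := Finset.card_le_card hsub2
      rw [Finset.card_pair hne, Finset.card_erase_of_mem hu] at this
      omega
    have h3 : 3 ≤ (nsums f {i, j}).card := by
      have hss : ({f i, f j, f i + f j} : Finset M) ⊆ nsums f {i, j} := by
        intro x hx
        simp only [Finset.mem_insert, Finset.mem_singleton] at hx
        rcases hx with rfl | rfl | rfl
        · exact mem_nsums.2 ⟨{i}, by simp, by simp, by simp⟩
        · exact mem_nsums.2 ⟨{j}, by simp, by simp, by simp⟩
        · exact mem_nsums.2 ⟨{i, j}, by simp, by simp, Finset.sum_pair hne⟩
      have hfi : f i ≠ 0 := by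
        simpa using hfree {i} (by simpa using hsub2 (by simp : i ∈ _)) (by simp)
      have hfj : f j ≠ 0 := by
        simpa using hfree {j} (by simpa using hsub2 (by simp : j ∈ _)) (by simp)
      have := Finset.card_le_card hss
      rwa [Finset.card_eq_three.2 ⟨f i, f j, f i + f j, hij, by simpa using hfj,
        by simpa using hfi, rfl⟩] at this
    omega

theorem castn_eq_zero (n : ℕ) (hn : 2 ≤ n) (x : ZMod (2 * n))
    (hx : ZMod.castHom (Dvd.intro_left 2 rfl : n ∣ 2 * n) (ZMod n) x = 0) :
    x = 0 ∨ x = (n : ZMod (2 * n)) := by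
  have : NeZero (2 * n) := ⟨by omega⟩
  obtain ⟨k, hk, rfl⟩ : ∃ k, k < 2 * n ∧ ((k : ℕ) : ZMod (2 * n)) = x :=
    ⟨x.val, x.val_lt, ZMod.natCast_zmod_val x⟩
  rw [map_natCast, ZMod.natCast_eq_zero_iff] at hx
  obtain ⟨q, rfl⟩ := hx
  have : q < 2 := by
    by_contra h
    have : n * 2 ≤ n * q := Nat.mul_le_mul_left n (by omega)
    omega
  interval_cases q <;> simp

theorem sum_const_order {ι M : Type*} [DecidableEq ι] [AddCommGroup M]
    (f : ι → M) (I : Finset ι) (g : M) (hI : I.Nonempty) (hg : ∀ i ∈ I, f i = g)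
    (h0 : ∑ i ∈ I, f i = 0)
    (h : ∀ L ⊆ I, L.Nonempty → L ≠ I → ∑ i ∈ L, f i ≠ 0) : addOrderOf g = I.card := by
  rw [addOrderOf_eq_iff hI.card_pos]
  have key : ∀ L ⊆ I, ∑ i ∈ L, f i = L.card • g := fun L hL => by
    rw [Finset.sum_congr rfl (fun i hi => hg i (hL hi)), Finset.sum_const]
  refine ⟨by rw [← key I subset_rfl, h0], fun j hj hj0 => ?_⟩
  obtain ⟨L, hL, rfl⟩ := Finset.exists_subset_card_eq hj.le
  rw [← key L hL]
  exact h L hL (Finset.card_pos.1 hj0) (by rintro rfl; omega)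

theorem lemmaA (n : ℕ) (hn : 2 ≤ n) {ι : Type*} [Fintype ι] [DecidableEq ι]
    (hcard : n + 1 ≤ Fintype.card ι) (e : ι → ZMod (2 * n)) (h0 : ∑ i, e i = 0)
    (hmin : ∀ (I : Finset ι) (ε : ι → Prop) [DecidablePred ε], I.Nonempty → I ≠ Finset.univ →
      (∑ i ∈ I, (if ε i then e i else - e i)) = 0 →
      (∑ i ∈ Iᶜ, (if ε i then e i else - e i)) = 0 → False) :
    Fintype.card ι = n + 1 ∧ ∃ i0, e i0 = (n : ZMod (2 * n)) ∧ ∀ i, i ≠ i0 →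
      ZMod.castHom (Dvd.intro_left 2 rfl : n ∣ 2 * n) (ZMod n) (e i) ≠ 0 ∧ ∀ j, j ≠ i0 →
      ZMod.castHom (Dvd.intro_left 2 rfl : n ∣ 2 * n) (ZMod n) (e i) =
      ZMod.castHom (Dvd.intro_left 2 rfl : n ∣ 2 * n) (ZMod n) (e j) := by
  have : NeZero (2 * n) := ⟨by omega⟩
  have : NeZero n := ⟨by omega⟩
  set c := ZMod.castHom (Dvd.intro_left 2 rfl : n ∣ 2 * n) (ZMod n) with hc
  have hnn : (n : ZMod (2 * n)) + n = 0 := by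
    have := ZMod.natCast_self (2 * n)
    push_cast at this
    rw [← two_mul]; exact this
  have hcn : c (n : ZMod (2 * n)) = 0 := by simp [hc]
  have c0 : ∀ x, c x = 0 → x = 0 ∨ x = (n : ZMod (2 * n)) := castn_eq_zero n hn
  have hz : ∀ I : Finset ι, I.Nonempty → I ≠ Finset.univ → ∑ i ∈ I, e i ≠ 0 := by
    intro I h1 h2 h3
    have h4 := Finset.sum_add_sum_compl I e
    refine hmin I (fun _ => True) h1 h2 (by simpa using h3) ?_
    rw [h3, h0, zero_add] at h4
    simpa using h4
  have hcs : ∀ I : Finset ι, ∑ i ∈ I, c (e i) = c (∑ i ∈ I, e i) := fun I => (map_sum c e I).symm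
  -- existence of U
  obtain ⟨U, hU1, hU2, hU3⟩ : ∃ U : Finset ι, U.Nonempty ∧ U ≠ Finset.univ ∧
      c (∑ i ∈ U, e i) = 0 := by
    by_contra! hcon
    have : Nonempty ι := Fintype.card_pos_iff.1 (by omega)
    have h1 := psums_card (fun i => c (e i)) Finset.univ Finset.univ_nonempty (fun L _ h1 h2 => by
      rw [hcs]; exact hcon L h1 h2)
    have h2 : psums (fun i => c (e i)) Finset.univ ⊆ Finset.univ.erase 0 := by
      intro x hx
      obtain ⟨J, hJ, hJ1, hJ2, rfl⟩ := mem_psums.1 hx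
      simp only [Finset.mem_erase, Finset.mem_univ, and_true]
      rw [hcs]; exact hcon J hJ1 hJ2
    have h3 := Finset.card_le_card h2
    rw [Finset.card_erase_of_mem (Finset.mem_univ _), Finset.card_univ, ZMod.card] at h3
    rw [Finset.card_univ] at h1
    omega
  have hUn : ∑ i ∈ U, e i = (n : ZMod (2 * n)) := (c0 _ hU3).resolve_left (hz U hU1 hU2)
  have hVn : ∑ i ∈ Uᶜ, e i = (n : ZMod (2 * n)) := by
    have := Finset.sum_add_sum_compl U e
    rw [h0, hUn] at this
    linear_combination this - hnn
  have hV1 : (Uᶜ).Nonempty := by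
    rw [Finset.nonempty_iff_ne_empty]
    intro h; exact hU2 (by simpa using h)
  have hV2 : Uᶜ ≠ Finset.univ := by
    intro h; simp at h; simp [h] at hU1
  -- minimality
  have hminU : ∀ W : Finset ι, W ≠ Finset.univ → ∑ i ∈ W, e i = (n : ZMod (2 * n)) →
      ∀ L ⊆ W, L.Nonempty → L ≠ W → ∑ i ∈ L, c (e i) ≠ 0 := by
    intro W hW hWs L hL hL1 hL2 hL3
    rw [hcs] at hL3
    have hLn := (c0 _ hL3).resolve_left (hz L hL1 (by
      rintro rfl; exact hW (Finset.univ_subset_iff.1 hL)))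
    have := Finset.sum_sdiff (f := e) hL
    rw [hLn, hWs] at this
    refine hz (W \ L) ?_ ?_ (by simpa using this)
    · rw [Finset.sdiff_nonempty]; exact fun h => hL2 (hL.antisymm h)
    · intro h
      exact hW (Finset.univ_subset_iff.1 (h ▸ Finset.sdiff_subset))
  have hmU := hminU U hU2 hUn
  have hmV := hminU Uᶜ hV2 hVn
  have hdisj : Disjoint (psums (fun i => c (e i)) U) (psums (fun i => c (e i)) Uᶜ) := by
    rw [Finset.disjoint_left]
    intro x hx hx'
    obtain ⟨J, hJ, hJ1, hJ2, hJs⟩ := mem_psums.1 hx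
    obtain ⟨K, hK, hK1, hK2, hKs⟩ := mem_psums.1 hx'
    rw [← hKs, hcs, hcs, ← sub_eq_zero, ← map_sub] at hJs
    have hJc := Finset.sum_sdiff (f := e) hJ
    have hKc := Finset.sum_sdiff (f := e) hK
    rw [hUn] at hJc
    rw [hVn] at hKc
    obtain ⟨u, huU, huJ⟩ := Finset.exists_of_ssubset (Finset.ssubset_iff_subset_ne.2 ⟨hJ, hJ2⟩)
    have hUV : Disjoint U Uᶜ := disjoint_compl_right
    rcases c0 _ hJs with h | h
    · have hd : Disjoint J K := Finset.disjoint_of_subset_left hJ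
        (Finset.disjoint_of_subset_right hK hUV)
      have hd2 : Disjoint (U \ J) (Uᶜ \ K) := Finset.disjoint_of_subset_left Finset.sdiff_subset
        (Finset.disjoint_of_subset_right Finset.sdiff_subset hUV)
      have hcompl : (J ∪ K)ᶜ = (U \ J) ∪ (Uᶜ \ K) := by
        ext i
        have h1 := @hJ i
        have h2 := @hK i
        simp only [Finset.mem_compl, Finset.mem_union, Finset.mem_sdiff] at *
        tauto
      have hpos : ∀ L ⊆ U, ∑ i ∈ L, (if i ∈ U then e i else - e i) = ∑ i ∈ L, e i := fun L hL =>
        Finset.sum_congr rfl (fun i hi => by rw [if_pos (hL hi)])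
      have hneg : ∀ L ⊆ Uᶜ, ∑ i ∈ L, (if i ∈ U then e i else - e i) = - ∑ i ∈ L, e i :=
        fun L hL => by
        rw [← Finset.sum_neg_distrib]
        exact Finset.sum_congr rfl (fun i hi => by rw [if_neg (Finset.mem_compl.1 (hL hi))])
      refine hmin (J ∪ K) (fun i => i ∈ U) (hJ1.mono Finset.subset_union_left) ?_ ?_ ?_
      · intro hh
        have : u ∈ J ∪ K := hh ▸ Finset.mem_univ u
        rcases Finset.mem_union.1 this with h | h
        · exact huJ h
        · exact (Finset.mem_compl.1 (hK h)) huU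
      · rw [Finset.sum_union hd, hpos J hJ, hneg K hK]
        linear_combination h
      · rw [hcompl, Finset.sum_union hd2, hpos _ Finset.sdiff_subset, hneg _ Finset.sdiff_subset]
        linear_combination hJc - hKc - h
    · have hd : Disjoint J (Uᶜ \ K) := Finset.disjoint_of_subset_left hJ
        (Finset.disjoint_of_subset_right Finset.sdiff_subset hUV)
      refine hz (J ∪ (Uᶜ \ K)) (hJ1.mono Finset.subset_union_left) ?_ ?_
      · intro hh
        have : u ∈ J ∪ (Uᶜ \ K) := hh ▸ Finset.mem_univ u
        rcases Finset.mem_union.1 this with h | h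
        · exact huJ h
        · exact (Finset.mem_compl.1 (Finset.sdiff_subset h)) huU
      · rw [Finset.sum_union hd]
        linear_combination h + hKc + hnn
  have hsub0 : psums (fun i => c (e i)) U ∪ psums (fun i => c (e i)) Uᶜ ⊆ Finset.univ.erase 0 := by
    intro x hx
    simp only [Finset.mem_erase, Finset.mem_univ, and_true]
    rcases Finset.mem_union.1 hx with hx | hx
    · obtain ⟨J, hJ, hJ1, hJ2, rfl⟩ := mem_psums.1 hx
      exact hmU J hJ hJ1 hJ2
    · obtain ⟨J, hJ, hJ1, hJ2, rfl⟩ := mem_psums.1 hx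
      exact hmV J hJ hJ1 hJ2
  have hcd := Finset.card_le_card hsub0
  rw [Finset.card_union_of_disjoint hdisj, Finset.card_erase_of_mem (Finset.mem_univ _),
    Finset.card_univ, ZMod.card] at hcd
  have hkU := psums_card _ U hU1 hmU
  have hkV := psums_card _ Uᶜ hV1 hmV
  have hUV := Finset.card_add_card_compl U
  have hcardeq : Fintype.card ι = n + 1 := by omega
  have hcU : ∀ i ∈ U, ∀ j ∈ U, c (e i) = c (e j) := by
    intro i hi j hj
    by_contra hne
    have := psums_card_of_ne _ U hmU i j hi hj hne
    omega
  have hcV : ∀ i ∈ Uᶜ, ∀ j ∈ Uᶜ, c (e i) = c (e j) := by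
    intro i hi j hj
    by_contra hne
    have := psums_card_of_ne _ Uᶜ hmV i j hi hj hne
    omega
  refine ⟨hcardeq, ?_⟩
  have hord : ∀ W : Finset ι, W.Nonempty → ∑ i ∈ W, e i = (n : ZMod (2 * n)) →
      (∀ i ∈ W, ∀ j ∈ W, c (e i) = c (e j)) →
      (∀ L ⊆ W, L.Nonempty → L ≠ W → ∑ i ∈ L, c (e i) ≠ 0) → W.card ∣ n := by
    rintro W ⟨w, hw⟩ h1 h2 h3
    rw [← sum_const_order (fun i => c (e i)) W (c (e w)) ⟨w, hw⟩ (fun i hi => h2 i hi w hw)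
      (by rw [hcs, h1, hcn]) h3]
    rw [addOrderOf_dvd_iff_nsmul_eq_zero]
    simp
  have hdU := hord U hU1 hUn hcU hmU
  have hdV := hord Uᶜ hV1 hVn hcV hmV
  have hfin : ∀ W : Finset ι, W.card = 1 → ∑ i ∈ W, e i = (n : ZMod (2 * n)) →
      (∀ i ∈ Wᶜ, ∀ j ∈ Wᶜ, c (e i) = c (e j)) →
      (∀ L ⊆ Wᶜ, L.Nonempty → L ≠ Wᶜ → ∑ i ∈ L, c (e i) ≠ 0) →
      ∃ i0, e i0 = (n : ZMod (2 * n)) ∧ ∀ i, i ≠ i0 → c (e i) ≠ 0 ∧ ∀ j, j ≠ i0 →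
        c (e i) = c (e j) := by
    intro W hW h1 h2 h3
    have hWc := Finset.card_add_card_compl W
    obtain ⟨i0, rfl⟩ := Finset.card_eq_one.1 hW
    refine ⟨i0, by simpa using h1, fun i hi => ⟨?_, fun j hj => h2 i (by simpa using hi) j
      (by simpa using hj)⟩⟩
    have := h3 {i} (by simpa [eq_comm] using hi) (by simp) (by
      intro h; rw [← h] at hWc; simp at hWc; omega)
    simpa using this
  obtain ⟨q, hq⟩ := hdU
  obtain ⟨r, hr⟩ := hdV
  have hU0 := hU1.card_pos
  have hV0 := hV1.card_pos
  by_cases h1 : U.card = 1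
  · exact hfin U h1 hUn hcV hmV
  by_cases h2 : (Uᶜ).card = 1
  · refine hfin Uᶜ h2 hVn ?_ ?_ <;> rw [compl_compl] <;> assumption
  exfalso
  have q2 : 2 ≤ q := by
    by_contra h
    interval_cases q <;> omega
  have r2 : 2 ≤ r := by
    by_contra h
    interval_cases r <;> omega
  have := Nat.mul_le_mul_left U.card q2
  have := Nat.mul_le_mul_left (Uᶜ).card r2
  omega

theorem lemmaD (n : ℕ) (hn : 2 ≤ n) {ι : Type*} [Fintype ι] [DecidableEq ι]
    (hcard : Fintype.card ι = n + 1) (a b : ι → ZMod (2 * n))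
    (h0 : ∑ i, (a i - b i + (n : ZMod (2 * n))) = 0)
    (H : ∀ π : Equiv.Perm ι, ∃ i0, a i0 - b (π i0) + n = (n : ZMod (2 * n)) ∧ ∀ i, i ≠ i0 →
      ZMod.castHom (Dvd.intro_left 2 rfl : n ∣ 2 * n) (ZMod n) (a i - b (π i) + n) ≠ 0 ∧
      ∀ j, j ≠ i0 →
      ZMod.castHom (Dvd.intro_left 2 rfl : n ∣ 2 * n) (ZMod n) (a i - b (π i) + n) =
      ZMod.castHom (Dvd.intro_left 2 rfl : n ∣ 2 * n) (ZMod n) (a j - b (π j) + n)) :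
    ∃ (x : ZMod (2 * n)) (s : Multiset (ZMod (2 * n))), Multiset.card s = n ∧
      Finset.univ.val.map a + Finset.univ.val.map b = Multiset.replicate (n + 2) x + s ∧
      (∀ z ∈ s, ZMod.castHom (Dvd.intro_left 2 rfl : n ∣ 2 * n) (ZMod n) z ≠
        ZMod.castHom (Dvd.intro_left 2 rfl : n ∣ 2 * n) (ZMod n) x) ∧
      (∀ z ∈ s, ∀ w ∈ s, ZMod.castHom (Dvd.intro_left 2 rfl : n ∣ 2 * n) (ZMod n) z =
        ZMod.castHom (Dvd.intro_left 2 rfl : n ∣ 2 * n) (ZMod n) w) ∧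
      s.sum + x = ((n : ZMod (2 * n)) + 1) * (x + n) := by
  set c := ZMod.castHom (Dvd.intro_left 2 rfl : n ∣ 2 * n) (ZMod n) with hc
  have hnn : (n : ZMod (2 * n)) + n = 0 := by
    have := ZMod.natCast_self (2 * n)
    push_cast at this
    rw [← two_mul]; exact this
  have hcn : c (n : ZMod (2 * n)) = 0 := by simp [hc]
  have hcc : ∀ u v, c (u - v + n) = c u - c v := fun u v => by rw [map_add, map_sub, hcn, add_zero]
  simp only [hcc] at H
  obtain ⟨i0, hi0, hrest⟩ := H 1
  simp only [Equiv.Perm.coe_one, id] at hi0 hrest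
  have hab : a i0 = b i0 := by linear_combination hi0
  set x := a i0 with hx
  -- key exact-equality fact
  have key : ∀ (π : Equiv.Perm ι) i, c (a i) = c (b (π i)) → a i = b (π i) ∧
      ∀ j, j ≠ i → c (a j) ≠ c (b (π j)) := by
    intro π i hi
    obtain ⟨i1, hi1, h1⟩ := H π
    have : i = i1 := by
      by_contra hne
      exact (h1 i hne).1 (by rw [hi, sub_self])
    subst this
    exact ⟨by linear_combination hi1, fun j hj hh => (h1 j hj).1 (by rw [hh, sub_self])⟩
  have hkind : ∀ i, i ≠ i0 → c (b i) = c x ∨ c (a i) = c x := by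
    intro i hi
    obtain ⟨i1, hi1, h1⟩ := H (Equiv.swap i0 i)
    by_cases h2 : i1 = i0
    · subst h2
      rw [Equiv.swap_apply_left] at hi1
      left; congr 1; linear_combination -hi1
    by_cases h3 : i1 = i
    · subst h3
      rw [Equiv.swap_apply_right] at hi1
      right; congr 1; rw [hab]; linear_combination hi1
    · exfalso
      rw [Equiv.swap_apply_of_ne_of_ne h2 h3] at hi1
      have h4 := (hrest i1 h2).1
      apply h4
      have : a i1 = b i1 := by linear_combination hi1
      rw [this, sub_self]
  have hnot : ∀ i j, i ≠ i0 → j ≠ i0 → c (b i) = c x → c (a j) = c x → False := by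
    intro i j hi hj h1 h2
    have hij : i ≠ j := by
      rintro rfl
      exact (hrest i hi).1 (by rw [h1, h2, sub_self])
    have h3 := (key (Equiv.swap i j) j (by rw [Equiv.swap_apply_right, h1, h2])).2 i0 hj.symm
    rw [Equiv.swap_apply_of_ne_of_ne hi.symm hj.symm, ← hab] at h3
    exact h3 rfl
  have hcardE : (Finset.univ.erase i0).card = n := by
    rw [Finset.card_erase_of_mem (Finset.mem_univ _), Finset.card_univ, hcard]; rfl
  have huniv : (Finset.univ : Finset ι).val = i0 ::ₘ (Finset.univ.erase i0).val := by
    rw [Finset.erase_val, Multiset.cons_erase]; simp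
  have hsumE : ∀ f : ι → ZMod (2 * n), ∑ i, f i = f i0 + ∑ i ∈ Finset.univ.erase i0, f i :=
    fun f => (Finset.add_sum_erase _ f (Finset.mem_univ i0)).symm
  have hsum2 : ∑ i, a i - ∑ i, b i + ((n : ZMod (2 * n)) + 1) * n = 0 := by
    rw [Finset.sum_add_distrib, Finset.sum_sub_distrib, Finset.sum_const, Finset.card_univ,
      hcard, nsmul_eq_mul] at h0
    push_cast at h0
    exact h0
  have hcases : (∀ i, c (b i) = c x) ∨ (∀ i, c (a i) = c x) := by
    by_cases hex : ∃ i, i ≠ i0 ∧ c (b i) = c x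
    · obtain ⟨i, hi, hbi⟩ := hex
      left
      intro j
      by_cases hj : j = i0
      · rw [hj, ← hab]
      · exact (hkind j hj).resolve_right (fun h => hnot i j hi hj hbi h)
    · push Not at hex
      right
      intro j
      by_cases hj : j = i0
      · rw [hj]
      · exact (hkind j hj).resolve_left (hex j hj)
  rcases hcases with hB | hA
  · have hb : ∀ i, b i = x := by
      intro i
      have := (key (Equiv.swap i0 i) i0 (by rw [Equiv.swap_apply_left, hB])).1
      rw [Equiv.swap_apply_left] at this
      exact this.symm
    refine ⟨x, (Finset.univ.erase i0).val.map a, by simpa using hcardE, ?_, ?_, ?_, ?_⟩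
    · have : Finset.univ.val.map b = Multiset.replicate (n + 1) x := by
        rw [Multiset.eq_replicate]
        refine ⟨by simpa using hcard, ?_⟩
        intro z hz
        obtain ⟨i, -, rfl⟩ := Multiset.mem_map.1 hz
        exact hb i
      rw [this, huniv, Multiset.map_cons, ← hx, Multiset.replicate_succ x (n + 1),
        Multiset.cons_add, Multiset.cons_add, add_comm]
    · intro z hz
      obtain ⟨i, hi, rfl⟩ := Multiset.mem_map.1 hz
      have hi' : i ≠ i0 := (Finset.mem_erase.1 hi).1
      intro hh
      exact (hrest i hi').1 (by rw [hh, hB, sub_self])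
    · intro z hz w hw
      obtain ⟨i, hi, rfl⟩ := Multiset.mem_map.1 hz
      obtain ⟨j, hj, rfl⟩ := Multiset.mem_map.1 hw
      have := (hrest i (Finset.mem_erase.1 hi).1).2 j (Finset.mem_erase.1 hj).1
      rw [hB, hB] at this
      exact sub_left_injective this
    · change ∑ i ∈ Finset.univ.erase i0, a i + x = _
      rw [hsumE a, ← hx, Finset.sum_congr rfl (fun i _ => hb i), Finset.sum_const,
        Finset.card_univ, hcard, nsmul_eq_mul] at hsum2
      push_cast at hsum2
      linear_combination hsum2 - ((n : ZMod (2 * n)) + 1) * hnn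
  · have ha : ∀ i, a i = x := by
      intro i
      have := (key (Equiv.swap i0 i) i (by rw [Equiv.swap_apply_right, hA, hab])).1
      rw [Equiv.swap_apply_right] at this
      rw [this, ← hab]
    refine ⟨x, (Finset.univ.erase i0).val.map b, by simpa using hcardE, ?_, ?_, ?_, ?_⟩
    · have : Finset.univ.val.map a = Multiset.replicate (n + 1) x := by
        rw [Multiset.eq_replicate]
        refine ⟨by simpa using hcard, ?_⟩
        intro z hz
        obtain ⟨i, -, rfl⟩ := Multiset.mem_map.1 hz
        exact ha i
      rw [this, huniv, Multiset.map_cons, ← hab, Multiset.replicate_succ x (n + 1),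
        Multiset.cons_add, Multiset.add_cons]
    · intro z hz
      obtain ⟨i, hi, rfl⟩ := Multiset.mem_map.1 hz
      have hi' : i ≠ i0 := (Finset.mem_erase.1 hi).1
      intro hh
      exact (hrest i hi').1 (by rw [hh, hA, sub_self])
    · intro z hz w hw
      obtain ⟨i, hi, rfl⟩ := Multiset.mem_map.1 hz
      obtain ⟨j, hj, rfl⟩ := Multiset.mem_map.1 hw
      have := (hrest i (Finset.mem_erase.1 hi).1).2 j (Finset.mem_erase.1 hj).1
      rw [hA i, hA j] at this
      exact sub_right_injective this
    · change ∑ i ∈ Finset.univ.erase i0, b i + x = _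
      rw [hsumE b, ← hab, Finset.sum_congr rfl (fun i _ => ha i), Finset.sum_const,
        Finset.card_univ, hcard, nsmul_eq_mul] at hsum2
      push_cast at hsum2
      linear_combination -hsum2

theorem list_pairs {M : Type*} (l : List M) :
    (∃ p : List (M × M), l = p.flatMap (fun q => [q.1, q.2])) ∨
    (∃ x, ∃ p : List (M × M), l = x :: p.flatMap (fun q => [q.1, q.2])) := by
  induction l with
  | nil => exact Or.inl ⟨[], rfl⟩
  | cons y l ih =>
    rcases ih with ⟨p, rfl⟩ | ⟨x, p, rfl⟩
    · exact Or.inr ⟨y, p, rfl⟩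
    · exact Or.inl ⟨(y, x) :: p, rfl⟩

theorem multiset_fin {M : Type*} (s : Multiset M) (k : ℕ) (h : Multiset.card s = k) :
    ∃ f : Fin k → M, s = (Finset.univ : Finset (Fin k)).val.map f := by
  obtain ⟨l, rfl⟩ : ∃ l : List M, (l : Multiset M) = s := ⟨s.toList, s.coe_toList⟩
  obtain rfl : l.length = k := by simpa using h
  refine ⟨l.get, ?_⟩
  rw [Fin.univ_val_map]
  simp

/-- Final classification of the remainder. -/
theorem lemmaE (n : ℕ) (hn : 2 ≤ n) (x : ZMod (2 * n)) (s : Multiset (ZMod (2 * n)))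
    (hs : Multiset.card s = n)
    (h1 : ∀ z ∈ s, ZMod.castHom (Dvd.intro_left 2 rfl : n ∣ 2 * n) (ZMod n) z ≠
        ZMod.castHom (Dvd.intro_left 2 rfl : n ∣ 2 * n) (ZMod n) x)
    (h2 : ∀ z ∈ s, ∀ w ∈ s, ZMod.castHom (Dvd.intro_left 2 rfl : n ∣ 2 * n) (ZMod n) z =
        ZMod.castHom (Dvd.intro_left 2 rfl : n ∣ 2 * n) (ZMod n) w)
    (h3 : s.sum + x = ((n : ZMod (2 * n)) + 1) * (x + n)) :
    (3 ≤ n ∧ ∃ y, ∃ ys : Fin (n - 3) → ZMod (2 * n),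
      s = Multiset.replicate 2 y + {y + (n : ZMod (2 * n))} +
        Multiset.map ys (Finset.univ : Finset (Fin (n - 3))).val) ∨
    (∃ y, s = Multiset.replicate n y) := by
  have hnn : (n : ZMod (2 * n)) + n = 0 := by
    have := ZMod.natCast_self (2 * n)
    push_cast at this
    rw [← two_mul]; exact this
  have hs0 : s ≠ 0 := by rintro rfl; simp at hs; omega
  obtain ⟨z, hz⟩ := Multiset.exists_mem_of_ne_zero hs0
  by_cases hall : ∀ w ∈ s, w = z
  · exact Or.inr ⟨z, Multiset.eq_replicate.2 ⟨hs, hall⟩⟩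
  left
  push Not at hall
  obtain ⟨w, hw, hwz⟩ := hall
  have hor : ∀ u ∈ s, ∀ v ∈ s, u = v ∨ u = v + n := by
    intro u hu v hv
    have := h2 u hu v hv
    rw [← sub_eq_zero, ← map_sub] at this
    rcases castn_eq_zero n hn _ this with h | h
    · left; linear_combination h
    · right; linear_combination h
  have hwz' : w = z + n := (hor w hw z hz).resolve_left hwz
  have hzw' : z = w + n := by rw [hwz']; linear_combination -hnn
  obtain ⟨t, ht⟩ : ∃ t, s = z ::ₘ w ::ₘ t := by
    obtain ⟨t, rfl⟩ := Multiset.exists_cons_of_mem hz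
    rcases Multiset.mem_cons.1 hw with h | h
    · exact absurd h hwz
    · obtain ⟨t', rfl⟩ := Multiset.exists_cons_of_mem h
      exact ⟨t', rfl⟩
  have htc : Multiset.card t = n - 2 := by
    rw [ht] at hs; simp at hs; omega
  by_cases hn2 : n = 2
  · exfalso
    subst hn2
    have ht0 : t = 0 := Multiset.card_eq_zero.1 (by simpa using htc)
    subst ht0
    apply h1 z hz
    rw [ht] at h3
    simp only [Multiset.sum_cons, Multiset.sum_zero, hwz'] at h3
    clear * - h3
    revert z x
    decide
  have h3n : 3 ≤ n := by omega
  refine ⟨h3n, ?_⟩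
  obtain ⟨v, hv⟩ : ∃ v, v ∈ t := by
    apply Multiset.exists_mem_of_ne_zero
    rintro rfl
    simp at htc; omega
  obtain ⟨r, rfl⟩ := Multiset.exists_cons_of_mem hv
  have hvs : v ∈ s := by rw [ht]; simp
  obtain ⟨ys, hys⟩ := multiset_fin r (n - 3) (by simp at htc; omega)
  rcases hor v hvs z hz with h | h
  · refine ⟨z, ys, ?_⟩
    rw [← hys, ← hwz', ht, h]
    ext q
    simp [Multiset.replicate_succ, Multiset.count_cons]
    ring
  · rw [← hwz'] at h
    refine ⟨w, ys, ?_⟩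
    rw [← hys, ← hzw', ht, h]
    ext q
    simp [Multiset.replicate_succ, Multiset.count_cons]
    ring

theorem exists_expHom (n : ℕ) (hn : 2 ≤ n)
    (G : Type*) [Group G] (α τ : G) (hcardG : Nat.card G = 4 * n)
    (hgen : Subgroup.closure {α, τ} = ⊤) (hα : α ^ (2 * n) = 1) (hτ : τ ^ 2 = α ^ n)
    (hrel : τ * α = α⁻¹ * τ) :
    ∃ E : ZMod (2 * n) → G, (∀ k : ℤ, E (k : ZMod (2 * n)) = α ^ k) ∧
      (∀ a b, E (a + b) = E a * E b) ∧ E 0 = 1 ∧ (∀ a, E a = 1 → a = 0) ∧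
      (∀ a b, (E a * τ) * (E b * τ) = E (a - b + n)) ∧
      (∀ g, g ∉ Subgroup.zpowers α → ∃ a, g = E a * τ) := by
  have : NeZero (2 * n) := ⟨by omega⟩
  let F : ZMod (2 * n) →+ Additive G := ZMod.lift (2 * n)
    ⟨zmultiplesHom (Additive G) (Additive.ofMul α), by
      simp only [zmultiplesHom_apply, natCast_zsmul]
      rw [← ofMul_pow, hα]; rfl⟩
  let E : ZMod (2 * n) → G := fun a => (F a).toMul
  have hE : ∀ k : ℤ, E (k : ZMod (2 * n)) = α ^ k := by
    intro k
    change (F (k : ZMod (2 * n))).toMul = _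
    rw [ZMod.lift_coe]
    rfl
  have hadd : ∀ a b, E (a + b) = E a * E b := by
    intro a b
    change (F (a + b)).toMul = _
    rw [map_add]; rfl
  have hzero : E 0 = 1 := by
    change (F 0).toMul = _
    rw [map_zero]; rfl
  have hneg : ∀ a, E (-a) = (E a)⁻¹ := by
    intro a
    change (F (-a)).toMul = _
    rw [map_neg]; rfl
  have hsurj : ∀ a : ZMod (2 * n), ∃ k : ℤ, (k : ZMod (2 * n)) = a := ZMod.intCast_surjective
  have hpow : ∀ k : ℤ, τ * α ^ k = α ^ (-k) * τ := by
    intro k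
    have h1 : SemiconjBy τ α α⁻¹ := hrel
    have := (h1.zpow_right k).eq
    rw [this, inv_zpow, zpow_neg]
  have hEτ : ∀ a, τ * E a = (E a)⁻¹ * τ := by
    intro a
    obtain ⟨k, rfl⟩ := hsurj a
    rw [hE, hpow, zpow_neg]
  have hEn : E (n : ZMod (2 * n)) = τ * τ := by
    have := hE n
    rw [Int.cast_natCast, zpow_natCast, ← hτ, pow_two] at this
    exact this
  have hpair : ∀ a b, (E a * τ) * (E b * τ) = E (a - b + n) := by
    intro a b
    rw [hadd, hEn, sub_eq_add_neg, hadd, hneg, mul_assoc, ← mul_assoc τ, hEτ]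
    group
  have hττ : τ⁻¹ = E (-(n : ZMod (2 * n))) * τ := by
    rw [hneg, hEn]; group
  have hall : ∀ g : G, (∃ a, g = E a) ∨ (∃ a, g = E a * τ) := by
    intro g
    have hg : g ∈ Subgroup.closure {α, τ} := by rw [hgen]; trivial
    induction hg using Subgroup.closure_induction with
    | mem x hx =>
      rcases hx with rfl | rfl
      · exact Or.inl ⟨((1 : ℤ) : ZMod (2 * n)), by rw [hE]; simp⟩
      · exact Or.inr ⟨0, by rw [hzero]; simp⟩
    | one => exact Or.inl ⟨0, hzero.symm⟩
    | mul x y _ _ hx hy =>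
      rcases hx with ⟨a, rfl⟩ | ⟨a, rfl⟩ <;> rcases hy with ⟨b, rfl⟩ | ⟨b, rfl⟩
      · exact Or.inl ⟨a + b, (hadd a b).symm⟩
      · exact Or.inr ⟨a + b, by rw [hadd, mul_assoc]⟩
      · exact Or.inr ⟨a - b, by rw [sub_eq_add_neg, hadd, hneg, mul_assoc, hEτ, mul_assoc]⟩
      · exact Or.inl ⟨_, hpair a b⟩
    | inv x _ hx =>
      rcases hx with ⟨a, rfl⟩ | ⟨a, rfl⟩
      · exact Or.inl ⟨-a, (hneg a).symm⟩
      · refine Or.inr ⟨a - n, ?_⟩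
        rw [inv_eq_iff_mul_eq_one, hpair]
        rw [show a - (a - (n : ZMod (2 * n))) + n = ((2 * n : ℕ) : ZMod (2 * n)) by
          push_cast; ring, ZMod.natCast_self, hzero]
  have hEα : ∀ a, E a ∈ Subgroup.zpowers α := by
    intro a
    obtain ⟨k, rfl⟩ := hsurj a
    exact ⟨k, (hE k).symm⟩
  have hord : orderOf α = 2 * n := by
    have hd : orderOf α ∣ 2 * n := orderOf_dvd_of_pow_eq_one hα
    have hfin : Finite G := Nat.finite_of_card_ne_zero (by omega)
    refine Nat.le_antisymm (Nat.le_of_dvd (by omega) hd) ?_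
    let f : Bool × Subgroup.zpowers α → G := fun p => if p.1 then p.2.1 * τ else p.2.1
    have hf : Function.Surjective f := by
      intro g
      rcases hall g with ⟨a, rfl⟩ | ⟨a, rfl⟩
      · exact ⟨(false, ⟨E a, hEα a⟩), by simp [f]⟩
      · exact ⟨(true, ⟨E a, hEα a⟩), by simp [f]⟩
    have := Nat.card_le_card_of_surjective f hf
    rw [Nat.card_prod, Nat.card_zpowers, hcardG] at this
    simp at this
    omega
  refine ⟨E, hE, hadd, hzero, ?_, hpair, ?_⟩
  · intro a ha
    obtain ⟨k, rfl⟩ := hsurj a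
    rw [hE, ← orderOf_dvd_iff_zpow_eq_one, hord] at ha
    exact (ZMod.intCast_zmod_eq_zero_iff_dvd k (2 * n)).2 ha
  · intro g hg
    rcases hall g with ⟨a, rfl⟩ | h
    · exact absurd (hEα a) hg
    · exact h

/-- A family of pairs whose signed sum vanishes gives a product-one sequence. -/
theorem pairs_productOne (n : ℕ) {G : Type*} [Group G] (τ : G) (E : ZMod (2 * n) → G)
    (hadd : ∀ a b, E (a + b) = E a * E b) (hzero : E 0 = 1)
    (hpair : ∀ a b, (E a * τ) * (E b * τ) = E (a - b + n)) {ι : Type*}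
    (a b : ι → ZMod (2 * n)) (ε : ι → Prop) [DecidablePred ε] (I : Finset ι)
    (hI : ∑ i ∈ I, (if ε i then (a i - b i + n) else -(a i - b i + n)) = 0) :
    IsProductOne (I.val.map (fun i => E (a i) * τ) + I.val.map (fun i => E (b i) * τ)) := by
  have hnn : (n : ZMod (2 * n)) + n = 0 := by
    have := ZMod.natCast_self (2 * n)
    push_cast at this
    rw [← two_mul]; exact this
  have hgen : ∀ L : List ι, ∃ l : List G,
      (l : Multiset G) = (L : Multiset ι).map (fun i => E (a i) * τ) +
        (L : Multiset ι).map (fun i => E (b i) * τ) ∧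
      l.prod = E ((L.map (fun i => if ε i then (a i - b i + n) else -(a i - b i + n))).sum) := by
    intro L
    induction L with
    | nil => exact ⟨[], by simp, by simp [hzero]⟩
    | cons i L ih =>
      obtain ⟨l, hl, hp⟩ := ih
      by_cases h : ε i
      · refine ⟨(E (a i) * τ) :: (E (b i) * τ) :: l, ?_, ?_⟩
        · rw [← Multiset.cons_coe, ← Multiset.cons_coe, hl, ← Multiset.cons_coe, Multiset.map_cons,
            Multiset.map_cons, Multiset.cons_add, Multiset.add_cons]
        · rw [List.prod_cons, List.prod_cons, ← mul_assoc, hpair, hp, List.map_cons, List.sum_cons,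
            if_pos h, hadd (_ - _ + _) (List.sum _)]
      · refine ⟨(E (b i) * τ) :: (E (a i) * τ) :: l, ?_, ?_⟩
        · rw [← Multiset.cons_coe, ← Multiset.cons_coe, hl, ← Multiset.cons_coe, Multiset.map_cons,
            Multiset.map_cons, Multiset.cons_add, Multiset.add_cons, Multiset.cons_swap]
        · rw [List.prod_cons, List.prod_cons, ← mul_assoc, hpair, hp, List.map_cons, List.sum_cons,
            if_neg h, hadd (-_) (List.sum _)]
          congr 2
          linear_combination hnn
  obtain ⟨l, hl, hp⟩ := hgen I.toList
  refine ⟨l, ?_, ?_⟩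
  · rw [hl, Finset.coe_toList]
  · rw [hp, Finset.sum_map_toList, hI, hzero]

theorem minimal_product_one_outside_cyclic_dicyclic
    (n : ℕ) (hn : 2 ≤ n)
    (G : Type*) [Group G] (α τ : G) (hcardG : Nat.card G = 4 * n)
    (hgen : Subgroup.closure {α, τ} = ⊤) (hα : α ^ (2 * n) = 1) (hτ : τ ^ 2 = α ^ n)
    (hrel : τ * α = α⁻¹ * τ)
    (S : Multiset G) (hS : IsMinimalProductOne S) (hlen : 2 * n + 2 ≤ Multiset.card S)
    (hsupp : ∀ g ∈ S, g ∉ Subgroup.zpowers α) :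
    Multiset.card S = 2 * n + 2 ∧
      ∃ x : ℤ, ∃ S₀ : Multiset G,
        x ∈ Set.Icc (0 : ℤ) (2 * (n : ℤ) - 1) ∧
        S = Multiset.replicate (n + 2) (α ^ x * τ) + S₀ ∧
        Multiset.card S₀ = n ∧
        ((3 ≤ n ∧
          ∃ y : ℤ, ∃ ys : Fin (n - 3) → ℤ,
            y ∈ Set.Icc (0 : ℤ) (2 * (n : ℤ) - 1) ∧
            (∀ i, ys i ∈ Set.Icc (0 : ℤ) (2 * (n : ℤ) - 1)) ∧
            ¬ (2 * y ≡ 2 * x [ZMOD (2 * (n : ℤ))]) ∧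
            (∀ i, ¬ (2 * ys i ≡ 2 * x [ZMOD (2 * (n : ℤ))])) ∧
            ((∑ i, ys i) + 3 * y + (n : ℤ) + x ≡ ((n : ℤ) + 1) * (x + (n : ℤ))
              [ZMOD (2 * (n : ℤ))]) ∧
            S₀ = Multiset.replicate 2 (α ^ y * τ) + {α ^ (y + (n : ℤ)) * τ} +
              Multiset.map (fun i => α ^ ys i * τ) (Finset.univ : Finset (Fin (n - 3))).val) ∨
        (∃ y : ℤ,
          y ∈ Set.Icc (0 : ℤ) (2 * (n : ℤ) - 1) ∧
          ¬ (2 * y ≡ 2 * x [ZMOD (2 * (n : ℤ))]) ∧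
          ((n : ℤ) * y + x ≡ ((n : ℤ) + 1) * (x + (n : ℤ)) [ZMOD (2 * (n : ℤ))]) ∧
          S₀ = Multiset.replicate n (α ^ y * τ))) := by
  have : NeZero (2 * n) := ⟨by omega⟩
  obtain ⟨E, hE, hadd, hzero, hinj, hpair, hrep⟩ :=
    exists_expHom n hn G α τ hcardG hgen hα hτ hrel
  have hEα : ∀ a, E a ∈ Subgroup.zpowers α := by
    intro a
    obtain ⟨k, rfl⟩ := ZMod.intCast_surjective a
    exact ⟨k, (hE k).symm⟩
  obtain ⟨hS0, ⟨l, hl, hlp⟩, hSmin⟩ := hS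
  -- represent the list by exponents
  obtain ⟨l', rfl⟩ : ∃ l' : List (ZMod (2 * n)), l = l'.map (fun a => E a * τ) := by
    have hmem : ∀ g ∈ l, ∃ a, E a * τ = g := by
      intro g hg
      obtain ⟨a, ha⟩ := hrep g (hsupp g (by rw [← hl]; simpa using hg))
      exact ⟨a, ha.symm⟩
    clear hl hlp
    induction l with
    | nil => exact ⟨[], rfl⟩
    | cons g l ih =>
      obtain ⟨l₁, hl₁⟩ := ih (fun g hg => hmem g (List.mem_cons_of_mem _ hg))
      obtain ⟨a, ha⟩ := hmem g List.mem_cons_self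
      exact ⟨a :: l₁, by rw [List.map_cons, ← hl₁, ha]⟩
  have hprod : ∀ p : List (ZMod (2 * n) × ZMod (2 * n)),
      ((p.flatMap (fun q => [q.1, q.2])).map (fun a => E a * τ)).prod =
        E ((p.map (fun q => q.1 - q.2 + (n : ZMod (2 * n)))).sum) := by
    intro p
    induction p with
    | nil => simp [hzero]
    | cons q p ih =>
      rw [List.flatMap_cons, List.map_append, List.prod_append, ih,
        List.map_cons (l := p), List.sum_cons, hadd _ (List.sum _), ← hpair]
      simp [mul_assoc]
  obtain ⟨p, rfl⟩ : ∃ p : List (ZMod (2 * n) × ZMod (2 * n)),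
      l' = p.flatMap (fun q => [q.1, q.2]) := by
    rcases list_pairs l' with h | ⟨x, p, rfl⟩
    · exact h
    · exfalso
      rw [List.map_cons, List.prod_cons, hprod] at hlp
      have hx : E x * τ ∈ S := by rw [← hl]; simp
      apply hsupp _ hx
      rw [eq_inv_of_mul_eq_one_left hlp]
      exact inv_mem (hEα _)
  rw [hprod] at hlp
  have hsum0 := hinj _ hlp
  let a : Fin p.length → ZMod (2 * n) := fun i => (p.get i).1
  let b : Fin p.length → ZMod (2 * n) := fun i => (p.get i).2
  have hSab : ∀ q : List (ZMod (2 * n) × ZMod (2 * n)),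
      ((q.flatMap (fun q => [q.1, q.2]) : List _) : Multiset (ZMod (2 * n))) =
      ((q.map Prod.fst : List _) : Multiset (ZMod (2 * n))) + ((q.map Prod.snd : List _) : Multiset _) := by
    intro q
    induction q with
    | nil => simp
    | cons r q ih =>
      rw [List.flatMap_cons, ← Multiset.coe_add, ih, List.map_cons, List.map_cons,
        ← Multiset.cons_coe (r.1) (q.map _), ← Multiset.cons_coe (r.2) (q.map _),
        Multiset.cons_add, Multiset.add_cons]
      rfl
  have ha' : Finset.univ.val.map a = ((p.map Prod.fst : List _) : Multiset (ZMod (2 * n))) := by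
    rw [Fin.univ_val_map]
    congr 1
    apply List.ext_get <;> simp [a]
  have hb' : Finset.univ.val.map b = ((p.map Prod.snd : List _) : Multiset (ZMod (2 * n))) := by
    rw [Fin.univ_val_map]
    congr 1
    apply List.ext_get <;> simp [b]
  have hSmap : S = (Finset.univ.val.map a + Finset.univ.val.map b).map (fun a => E a * τ) := by
    rw [ha', hb', ← hSab, ← hl]; rfl
  have hsum : ∑ i, (a i - b i + (n : ZMod (2 * n))) = 0 := by
    rw [← hsum0, ← List.sum_ofFn]
    congr 1
    apply List.ext_get <;> simp [a, b]
  have hcardp : n + 1 ≤ Fintype.card (Fin p.length) := by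
    rw [hSmap] at hlen
    simp at hlen ⊢
    omega
  have hA := fun π : Equiv.Perm (Fin p.length) => lemmaA n hn hcardp
    (fun i => a i - b (π i) + n) (by
      rw [← hsum, Finset.sum_add_distrib, Finset.sum_sub_distrib, Equiv.sum_comp π b,
        Finset.sum_add_distrib, Finset.sum_sub_distrib]) (by
      intro I ε _ hI1 hI2 h1 h2
      refine hSmin _ _ ?_ ?_
        (pairs_productOne n τ E hadd hzero hpair a (fun i => b (π i)) ε I h1)
        (pairs_productOne n τ E hadd hzero hpair a (fun i => b (π i)) ε Iᶜ h2) ?_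
      · intro h
        have := congrArg Multiset.card h
        simp at this
        simp [this] at hI1
      · intro h
        have := congrArg Multiset.card h
        simp only [Multiset.card_add, Multiset.card_map, Multiset.card_zero, Finset.card_val] at this
        have h3 : Iᶜ.card = 0 := by omega
        rw [Finset.card_eq_zero] at h3
        exact hI2 (by simpa using h3)
      · have hu : (Finset.univ : Finset (Fin p.length)).val = I.val + (Iᶜ).val := by
          rw [← Finset.union_compl I, ← Finset.disjUnion_eq_union _ _ disjoint_compl_right]
          rfl
        have hbπ : Finset.univ.val.map b = Finset.univ.val.map (fun i => b (π i)) := by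
          have h := Multiset.map_map b π (Finset.univ : Finset (Fin p.length)).val
          rw [Multiset.map_univ_val_equiv π] at h
          exact h
        rw [hSmap, hbπ, hu]
        simp only [Multiset.map_add, Multiset.map_map, Function.comp_def]
        abel)
  have hcardeq := (hA 1).1
  obtain ⟨x, s, hs, hxs, h1, h2, h3⟩ := lemmaD n hn hcardeq a b hsum (fun π => (hA π).2)
  rw [hxs, Multiset.map_add, Multiset.map_replicate] at hSmap
  have hv : ∀ z : ZMod (2 * n), ((z.val : ℤ) : ZMod (2 * n)) = z := fun z => by simp
  have hE' : ∀ z : ZMod (2 * n), α ^ (z.val : ℤ) = E z := fun z => by rw [← hE, hv]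
  have hIcc : ∀ z : ZMod (2 * n), (z.val : ℤ) ∈ Set.Icc (0 : ℤ) (2 * (n : ℤ) - 1) := by
    intro z
    have := z.val_lt
    constructor <;> omega
  have hmod : ∀ u v : ℤ, (u : ZMod (2 * n)) = v → u ≡ v [ZMOD (2 * (n : ℤ))] := by
    intro u v h
    have := (ZMod.intCast_eq_intCast_iff u v (2 * n)).1 h
    push_cast at this
    exact this
  have hne : ∀ z ∈ s, ¬ (2 * (z.val : ℤ) ≡ 2 * (x.val : ℤ) [ZMOD (2 * (n : ℤ))]) := by
    intro z hz hh
    have h4 : (z.val : ℤ) ≡ x.val [ZMOD (n : ℤ)] := Int.ModEq.mul_left_cancel' (by norm_num) hh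
    have h5 := (ZMod.intCast_eq_intCast_iff _ _ n).2 h4
    apply h1 z hz
    rw [← hv z, ← hv x, map_intCast, map_intCast]
    exact h5
  refine ⟨by rw [hSmap]; simp [hs]; omega, x.val, s.map (fun a => E a * τ), hIcc x,
    by rw [hE']; exact hSmap, by simpa using hs, ?_⟩
  rcases lemmaE n hn x s hs h1 h2 h3 with ⟨h3n, y, ys, hy⟩ | ⟨y, hy⟩
  · left
    refine ⟨h3n, y.val, fun i => (ys i).val, hIcc y, fun i => hIcc _, hne y (by rw [hy]; simp),
      fun i => hne _ (by rw [hy]; simp), ?_, ?_⟩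
    · apply hmod
      push_cast
      simp only [ZMod.natCast_zmod_val]
      rw [← h3, hy]
      have : (Multiset.map ys (Finset.univ : Finset (Fin (n - 3))).val).sum = ∑ i, ys i := rfl
      rw [Multiset.sum_add, Multiset.sum_add, this, Multiset.sum_replicate, Multiset.sum_singleton]
      simp only [nsmul_eq_mul]
      push_cast
      ring
    · rw [hy]
      simp only [Multiset.map_add, Multiset.map_replicate, Multiset.map_singleton,
        Multiset.map_map, Function.comp_def, hE']
      rw [← hE (_ + _)]
      push_cast
      simp
  · right
    refine ⟨y.val, hIcc y, hne y (by rw [hy]; exact Multiset.mem_replicate.2 ⟨by omega, rfl⟩), ?_, ?_⟩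
    · apply hmod
      push_cast
      simp only [ZMod.natCast_zmod_val]
      rw [← h3, hy, Multiset.sum_replicate, nsmul_eq_mul]
    · rw [hy, Multiset.map_replicate, hE']
end

section
/- Let G be an additively written cyclic group of order n ≥ 3 and let S be a zero-sum free sequence over G of length |S| ≥ (n+1)/2. Then there exists g ∈ G with ord(g) = n such that S is g-smooth, and moreover for every h ∈ Σ(S) there exists a subsequence T of S such that σ(T) = h and g occurs in T. -/
/-- The set of sums of non-empty subsequences (multiset divisors) of `S`. -/
def SubseqSums {G : Type*} [AddCommGroup G] (S : Multiset G) : Set G :=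
  {h | ∃ T : Multiset G, T ≤ S ∧ T ≠ 0 ∧ T.sum = h}

/-- A sequence is *zero-sum free* if no non-empty subsequence has sum zero. -/
def IsZeroSumFree {G : Type*} [AddCommGroup G] (S : Multiset G) : Prop :=
  ∀ T : Multiset G, T ≤ S → T ≠ 0 → T.sum ≠ 0

/-- A sequence `S` is *`g`-smooth* if `S = (n₁ g) · … · (n_ℓ g)` with
`1 = n₁ ≤ … ≤ n_ℓ`, `m = n₁ + … + n_ℓ < ord g` and `Σ(S) = {g, 2g, …, mg}`. -/
def IsSmooth {G : Type*} [AddCommGroup G] (g : G) (S : Multiset G) : Prop :=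
  ∃ c : Multiset ℕ, S = c.map (fun k => k • g) ∧ (∀ k ∈ c, 1 ≤ k) ∧ 1 ∈ c ∧
    c.sum < addOrderOf g ∧ SubseqSums S = (fun k => k • g) '' Set.Icc 1 c.sum

open Classical in
/-- The finset of all subsequence sums, including the empty one. -/
noncomputable def ZSums {G : Type*} [AddCommGroup G] (S : Multiset G) : Finset G :=
  (S.powerset.map Multiset.sum).toFinset

lemma mem_ZSums {G : Type*} [AddCommGroup G] {S : Multiset G} {x : G} :
    x ∈ ZSums S ↔ ∃ T : Multiset G, T ≤ S ∧ T.sum = x := by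
  simp [ZSums]

/-- Strengthened smoothness, suited to induction. -/
def GoodSeq {G : Type*} [AddCommGroup G] (g : G) (c : Multiset ℕ) (S : Multiset G) : Prop :=
  S = c.map (fun k => k • g) ∧ (∀ k ∈ c, 1 ≤ k) ∧ 1 ∈ c ∧ c.sum < addOrderOf g ∧
    (∀ j, 1 ≤ j → j ≤ c.sum → ∃ t ≤ c, 1 ∈ t ∧ t.sum = j) ∧
    (∀ T ≤ S, ∃ k ≤ c.sum, T.sum = k • g)

lemma sum_map_nsmul {G : Type*} [AddCommGroup G] (g : G) (t : Multiset ℕ) :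
    (t.map (fun k => k • g)).sum = t.sum • g := by
  induction t using Multiset.induction with
  | empty => simp
  | cons a t ih => simp [ih, add_nsmul]

lemma GoodSeq.nsmul_mem {G : Type*} [AddCommGroup G] {g : G} {c : Multiset ℕ} {S : Multiset G}
    (h : GoodSeq g c S) {j : ℕ} (hj : j ≤ c.sum) : j • g ∈ ZSums S := by
  obtain ⟨h1, h2, h3, h4, h5, h6⟩ := h
  rw [mem_ZSums]
  rcases Nat.eq_zero_or_pos j with rfl | hp
  · exact ⟨0, by simp, by simp⟩
  · obtain ⟨t, ht, -, hs⟩ := h5 j hp hj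
    exact ⟨t.map (fun k => k • g), h1 ▸ Multiset.map_le_map ht, by rw [sum_map_nsmul, hs]⟩

lemma card_le_sum (c : Multiset ℕ) (h : ∀ k ∈ c, 1 ≤ k) : Multiset.card c ≤ c.sum := by
  have := Multiset.card_nsmul_le_sum h
  simpa using this

lemma GoodSeq.card_ge {G : Type*} [AddCommGroup G] {g : G} {c : Multiset ℕ} {S : Multiset G}
    (h : GoodSeq g c S) : Multiset.card S + 1 ≤ (ZSums S).card := by
  have h1 : Multiset.card S = Multiset.card c := by rw [h.1]; simp
  have h2 := card_le_sum c h.2.1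
  have h3 : (Finset.range (c.sum + 1)).card ≤ (ZSums S).card := by
    apply Finset.card_le_card_of_injOn (fun k => k • g)
    · intro k hk
      simp at hk
      exact h.nsmul_mem (by omega)
    · intro i hi j hj hij
      simp at hi hj
      have h4 := h.2.2.2.1
      exact nsmul_injOn_Iio_addOrderOf (by simp; omega) (by simp; omega) hij
  simp at h3
  omega

lemma GoodSeq.extend {G : Type*} [AddCommGroup G] {g a : G} {c : Multiset ℕ} {S : Multiset G}
    (h : GoodSeq g c S) (hz : IsZeroSumFree (a ::ₘ S))
    (hc : (ZSums (a ::ₘ S)).card + 1 ≤ 2 * Multiset.card (a ::ₘ S)) :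
    ∃ g : G, ∃ c : Multiset ℕ, GoodSeq g c (a ::ₘ S) := by
  classical
  have hneg : ∀ x ∈ ZSums S, a + x ≠ 0 := by
    intro x hx
    obtain ⟨T, hT, rfl⟩ := mem_ZSums.1 hx
    have := hz (a ::ₘ T) (Multiset.cons_le_cons a hT) (by simp)
    simpa using this
  have hnd : ¬ Disjoint (ZSums S) ((ZSums S).image (fun x => a + x)) := by
    intro hd
    have h1 := Finset.card_union_of_disjoint hd
    rw [Finset.card_image_of_injective _ (add_right_injective a)] at h1
    have h2 : ZSums S ∪ (ZSums S).image (fun x => a + x) ⊆ ZSums (a ::ₘ S) := by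
      intro x hx
      rw [Finset.mem_union, Finset.mem_image] at hx
      rw [mem_ZSums]
      rcases hx with hx | ⟨y, hy, rfl⟩
      · obtain ⟨T, hT, rfl⟩ := mem_ZSums.1 hx
        exact ⟨T, hT.trans (Multiset.le_cons_self _ _), rfl⟩
      · obtain ⟨T, hT, rfl⟩ := mem_ZSums.1 hy
        exact ⟨a ::ₘ T, Multiset.cons_le_cons a hT, by simp⟩
    have h3 := Finset.card_le_card h2
    have h4 := h.card_ge
    rw [Multiset.card_cons] at hc
    omega
  have hmem : ∀ {j : ℕ}, j ≤ c.sum → j • g ∈ ZSums S := fun hj => h.nsmul_mem hj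
  obtain ⟨h1, h2, h3, h4, h5, h6⟩ := h
  obtain ⟨x, hx, hx'⟩ := Finset.not_disjoint_iff.1 hnd
  obtain ⟨y, hy, hyx⟩ := Finset.mem_image.1 hx'
  obtain ⟨T, hT, rfl⟩ := mem_ZSums.1 hx
  obtain ⟨U, hU, rfl⟩ := mem_ZSums.1 hy
  obtain ⟨i, hi, hi'⟩ := h6 T hT
  obtain ⟨j, hj, hj'⟩ := h6 U hU
  simp only [hi', hj'] at hyx
  have hij : j < i := by
    by_contra hcon
    obtain ⟨d, rfl⟩ := Nat.exists_eq_add_of_le (not_lt.1 hcon)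
    apply hneg (d • g) (hmem (by omega))
    rw [add_nsmul] at hyx
    have : a + d • g + i • g = 0 + i • g := by
      rw [zero_add]; nth_rw 2 [← hyx]; abel
    exact add_right_cancel this
  obtain ⟨k, rfl⟩ := Nat.exists_eq_add_of_lt hij
  have ha : a = (k + 1) • g := by
    have : a + j • g = (k + 1) • g + j • g := by rw [hyx, ← add_nsmul]; congr 1; omega
    exact add_right_cancel this
  have hk1 : k + 1 ≤ c.sum := by omega
  have hord : c.sum + (k + 1) < addOrderOf g := by
    by_contra hcon
    apply hneg ((addOrderOf g - (k + 1)) • g) (hmem (by omega))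
    rw [ha, ← add_nsmul, Nat.add_sub_cancel' (by omega), addOrderOf_nsmul_eq_zero]
  refine ⟨g, (k + 1) ::ₘ c, ?_, ?_, ?_, ?_, ?_, ?_⟩
  · rw [Multiset.map_cons, ← h1, ← ha]
  · intro x hx
    rcases Multiset.mem_cons.1 hx with rfl | hx
    · omega
    · exact h2 x hx
  · exact Multiset.mem_cons_of_mem h3
  · rw [Multiset.sum_cons]; omega
  · intro r hr1 hr2
    rw [Multiset.sum_cons] at hr2
    by_cases hr : r ≤ c.sum
    · obtain ⟨t, ht, h1t, hs⟩ := h5 r hr1 hr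
      exact ⟨t, ht.trans (Multiset.le_cons_self _ _), h1t, hs⟩
    · obtain ⟨t, ht, h1t, hs⟩ := h5 (r - (k + 1)) (by omega) (by omega)
      refine ⟨(k + 1) ::ₘ t, Multiset.cons_le_cons _ ht, Multiset.mem_cons_of_mem h1t, ?_⟩
      rw [Multiset.sum_cons, hs]; omega
  · intro V hV
    rw [Multiset.sum_cons]
    by_cases haV : a ∈ V
    · obtain ⟨W, rfl⟩ := Multiset.exists_cons_of_mem haV
      obtain ⟨r, hr, hr'⟩ := h6 W ((Multiset.cons_le_cons_iff a).1 hV)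
      refine ⟨(k + 1) + r, by omega, ?_⟩
      rw [Multiset.sum_cons, hr', add_nsmul, ← ha]
    · obtain ⟨r, hr, hr'⟩ := h6 V ((Multiset.le_cons_of_notMem haV).1 hV)
      exact ⟨r, by omega, hr'⟩

theorem zsf_main {G : Type*} [AddCommGroup G] [Finite G] (m : ℕ) : ∀ S : Multiset G,
    Multiset.card S = m → IsZeroSumFree S → (ZSums S).card + 1 ≤ 2 * Multiset.card S →
    ∃ g : G, ∃ c : Multiset ℕ, GoodSeq g c S := by
  classical
  induction m with
  | zero =>
    intro S h0 _ hc
    omega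
  | succ m ih =>
    intro S hm hz hc
    by_cases hex : ∃ a ∈ S, (ZSums (S.erase a)).card + 3 ≤ 2 * (m + 1)
    · obtain ⟨a, ha, hca⟩ := hex
      obtain ⟨T, rfl⟩ := Multiset.exists_cons_of_mem ha
      rw [Multiset.erase_cons_head] at hca
      have hT : Multiset.card T = m := by simpa using hm
      obtain ⟨g, c, hg⟩ := ih T hT
        (fun U hU hU0 => hz U (hU.trans (Multiset.le_cons_self _ _)) hU0) (by omega)
      exact hg.extend hz hc
    · push Not at hex
      have hneg : ∀ a ∈ S, ∀ x ∈ ZSums (S.erase a), a + x ≠ 0 := by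
        intro a ha x hx
        obtain ⟨T, hT, rfl⟩ := mem_ZSums.1 hx
        have := hz (a ::ₘ T) (by
          rw [← Multiset.cons_erase ha]; exact Multiset.cons_le_cons a hT) (by simp)
        simpa using this
      have hsub : ∀ a ∈ S, ZSums (S.erase a) ⊆ (ZSums S).erase S.sum := by
        intro a ha x hx
        obtain ⟨T, hT, rfl⟩ := mem_ZSums.1 hx
        rw [Finset.mem_erase]
        refine ⟨?_, mem_ZSums.2 ⟨T, hT.trans (Multiset.erase_le a S), rfl⟩⟩
        intro heq
        obtain ⟨U, hU⟩ := Multiset.le_iff_exists_add.1 hT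
        have hS : S = a ::ₘ (T + U) := by rw [← hU, Multiset.cons_erase ha]
        apply hneg a ha U.sum (mem_ZSums.2 ⟨U, by rw [hU]; exact Multiset.le_add_left _ _, rfl⟩)
        have h2 : T.sum + (a + U.sum) = T.sum + 0 := by
          rw [add_zero]; nth_rw 2 [heq]; rw [hS]; simp only [Multiset.sum_cons, Multiset.sum_add]; abel
        exact add_left_cancel h2
      have hσ : S.sum ∈ ZSums S := mem_ZSums.2 ⟨S, le_rfl, rfl⟩
      have hB : ∀ a ∈ S, ZSums (S.erase a) = (ZSums S).erase S.sum := by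
        intro a ha
        apply Finset.eq_of_subset_of_card_le (hsub a ha)
        rw [Finset.card_erase_of_mem hσ]
        have := hex a ha
        omega
      have h0 : (0 : G) ∈ ZSums S := mem_ZSums.2 ⟨0, by simp, by simp⟩
      have hB' : ∀ a ∈ S, ((ZSums S).erase S.sum).image (fun x => a + x) = (ZSums S).erase 0 := by
        intro a ha
        apply Finset.eq_of_subset_of_card_le
        · intro y hy
          obtain ⟨x, hx, rfl⟩ := Finset.mem_image.1 hy
          rw [← hB a ha] at hx
          refine Finset.mem_erase.2 ⟨hneg a ha x hx, ?_⟩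
          obtain ⟨T, hT, rfl⟩ := mem_ZSums.1 hx
          refine mem_ZSums.2 ⟨a ::ₘ T, ?_, by simp⟩
          rw [← Multiset.cons_erase ha]; exact Multiset.cons_le_cons a hT
        · rw [Finset.card_image_of_injective _ (add_right_injective a),
            Finset.card_erase_of_mem hσ, Finset.card_erase_of_mem h0]
      obtain ⟨g, hg⟩ : ∃ g, g ∈ S := Multiset.card_pos_iff_exists_mem.1 (by omega)
      have hne : ∀ a ∈ S, a ≠ 0 := by
        intro a ha
        have := hneg a ha 0 (mem_ZSums.2 ⟨0, by simp, by simp⟩)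
        simpa using this
      have hall : ∀ a ∈ S, a = g := by
        intro a ha
        by_contra hag
        have h1 : a ∈ (ZSums S).erase 0 :=
          Finset.mem_erase.2 ⟨hne a ha, mem_ZSums.2 ⟨{a}, by simpa using ha, by simp⟩⟩
        rw [← hB' g hg] at h1
        obtain ⟨x, hx, hxa⟩ := Finset.mem_image.1 h1
        have h2 : x ∈ (ZSums S).erase 0 := by
          refine Finset.mem_erase.2 ⟨?_, Finset.mem_of_mem_erase hx⟩
          rintro rfl
          exact hag (by rw [← hxa, add_zero])
        rw [← hB' a ha] at h2
        obtain ⟨y, hy, hya⟩ := Finset.mem_image.1 h2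
        rw [← hB g hg] at hy
        apply hneg g hg y hy
        have h3 : a + (g + y) = a + 0 := by
          rw [add_zero]; nth_rw 2 [← hxa]; rw [← hya]; abel
        exact add_left_cancel h3
      have hrep : S = Multiset.replicate (m + 1) g := by
        rw [Multiset.eq_replicate]; exact ⟨hm, hall⟩
      refine ⟨g, Multiset.replicate (m + 1) 1, ?_, ?_, ?_, ?_, ?_, ?_⟩
      · rw [Multiset.map_replicate, one_nsmul, hrep]
      · intro k hk
        rw [Multiset.eq_of_mem_replicate hk]
      · simp
      · simp only [Multiset.sum_replicate, smul_eq_mul, mul_one]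
        by_contra hcon
        apply hz (Multiset.replicate (addOrderOf g) g)
        · rw [hrep]; exact (Multiset.replicate_le_replicate g).2 (by omega)
        · intro h
          have := congrArg Multiset.card h
          have h2 := addOrderOf_pos g
          rw [Multiset.card_replicate, Multiset.card_zero] at this
          omega
        · simp [addOrderOf_nsmul_eq_zero]
      · intro j hj1 hj2
        simp only [Multiset.sum_replicate, smul_eq_mul, mul_one] at hj2
        refine ⟨Multiset.replicate j 1, (Multiset.replicate_le_replicate 1).2 hj2, ?_, by simp⟩
        exact Multiset.mem_replicate.2 ⟨by omega, rfl⟩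
      · intro T hT
        have hTc := Multiset.card_le_card hT
        refine ⟨Multiset.card T, by simp; omega, ?_⟩
        have : T = Multiset.replicate (Multiset.card T) g :=
          Multiset.eq_replicate.2 ⟨rfl, fun b hb => hall b (Multiset.mem_of_le hT hb)⟩
        conv_lhs => rw [this]
        rw [Multiset.sum_replicate]

theorem zero_sum_free_long_is_smooth
    (n : ℕ) (hn : 3 ≤ n)
    (G : Type*) [AddCommGroup G] [Fintype G] (hcyc : IsAddCyclic G)
    (hcard : Fintype.card G = n)
    (S : Multiset G) (hzsf : IsZeroSumFree S) (hlen : n + 1 ≤ 2 * Multiset.card S) :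
    ∃ g : G, addOrderOf g = n ∧ IsSmooth g S ∧
      ∀ h ∈ SubseqSums S, ∃ T : Multiset G, T ≤ S ∧ T.sum = h ∧ g ∈ T := by
  obtain ⟨g, c, hg⟩ := zsf_main _ S rfl hzsf
    (by have := Finset.card_le_univ (ZSums S); omega)
  have hmem : ∀ {j : ℕ}, j ≤ c.sum → j • g ∈ ZSums S := fun hj => hg.nsmul_mem hj
  obtain ⟨h1, h2, h3, h4, h5, h6⟩ := hg
  have hss : SubseqSums S = (fun k => k • g) '' Set.Icc 1 c.sum := by
    ext x
    constructor
    · rintro ⟨T, hT, hT0, rfl⟩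
      obtain ⟨k, hk, hk'⟩ := h6 T hT
      refine ⟨k, ⟨?_, hk⟩, hk'.symm⟩
      rcases Nat.eq_zero_or_pos k with rfl | hp
      · exact absurd (by simpa using hk') (hzsf T hT hT0)
      · exact hp
    · rintro ⟨k, ⟨hk1, hk2⟩, rfl⟩
      obtain ⟨T, hT, hs⟩ := mem_ZSums.1 (hmem hk2)
      refine ⟨T, hT, ?_, hs⟩
      rintro rfl
      simp at hs
      have := Nat.le_of_dvd hk1 (addOrderOf_dvd_of_nsmul_eq_zero hs.symm)
      omega
  refine ⟨g, ?_, ⟨c, h1, h2, h3, h4, hss⟩, ?_⟩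
  · have hd : addOrderOf g ∣ n := hcard ▸ addOrderOf_dvd_card
    have hc := card_le_sum c h2
    have hc' : Multiset.card S = Multiset.card c := by rw [h1]; simp
    obtain ⟨q, hq⟩ := hd
    have hq1 : q < 2 := by
      by_contra hcon
      have : addOrderOf g * 2 ≤ addOrderOf g * q := Nat.mul_le_mul_left _ (by omega)
      omega
    interval_cases q <;> omega
  · intro h hh
    rw [hss] at hh
    obtain ⟨k, ⟨hk1, hk2⟩, rfl⟩ := hh
    obtain ⟨t, ht, h1t, hs⟩ := h5 k hk1 hk2
    refine ⟨t.map (fun k => k • g), h1 ▸ Multiset.map_le_map ht, by rw [sum_map_nsmul, hs], ?_⟩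
    exact Multiset.mem_map.2 ⟨1, h1t, one_nsmul g⟩
end

section
/- Let G be a finite group with |G| ≥ 3 and let j, l ∈ ℕ_0 be such that l·D(G) + j ≥ 1. Then 2l + 2j/D(G) ≤ λ_{l·D(G)+j}(G) ≤ 2l + j. In particular, λ_{l·D(G)}(G) = 2l for every l ∈ ℕ. -/
/-- The large Davenport constant `D(G)`: the maximal length of a minimal
product-one sequence over `G`. -/
noncomputable def DavenportLarge (G : Type*) [Group G] : ℕ :=
  sSup {m | ∃ S : Multiset G, IsMinimalProductOne S ∧ Multiset.card S = m}

/-- `k ∈ L(a)`: the product-one sequence `a` is a concatenation of `k` minimal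
product-one sequences. -/
def HasLength {G : Type*} [Group G] (a : Multiset G) (k : ℕ) : Prop :=
  ∃ f : Fin k → Multiset G, (∀ i, IsMinimalProductOne (f i)) ∧ (∑ i, f i) = a

/-- `U_k(G)`: the union of all sets of lengths `L(a)` with `k ∈ L(a)`. -/
def UnionLengths (G : Type*) [Group G] (k : ℕ) : Set ℕ :=
  {m | ∃ a : Multiset G, IsProductOne a ∧ HasLength a k ∧ HasLength a m}

/-- `ρ_k(G) = sup U_k(G)`. -/
noncomputable def rhoK (G : Type*) [Group G] (k : ℕ) : ℕ :=
  sSup (UnionLengths G k)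

/-- `λ_k(G) = min U_k(G)`. -/
noncomputable def lambdaK (G : Type*) [Group G] (k : ℕ) : ℕ :=
  sInf (UnionLengths G k)

theorem isProductOne_zero' {G : Type*} [Group G] : IsProductOne (0 : Multiset G) :=
  ⟨[], rfl, rfl⟩

theorem isProductOne_add' {G : Type*} [Group G] {S T : Multiset G}
    (hS : IsProductOne S) (hT : IsProductOne T) : IsProductOne (S + T) := by
  obtain ⟨s, rfl, hs⟩ := hS
  obtain ⟨t, rfl, ht⟩ := hT
  exact ⟨s ++ t, by simp, by simp [hs, ht]⟩

theorem isProductOne_singleton' {G : Type*} [Group G] {g : G}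
    (h : IsProductOne ({g} : Multiset G)) : g = 1 := by
  obtain ⟨s, hs, h1⟩ := h
  rw [Multiset.coe_eq_singleton] at hs
  subst hs
  simpa using h1

theorem isProductOne_inv' {G : Type*} [Group G] {S : Multiset G}
    (hS : IsProductOne S) : IsProductOne (S.map (fun g => g⁻¹)) := by
  obtain ⟨s, rfl, hs⟩ := hS
  refine ⟨(s.map (fun g => g⁻¹)).reverse, by simp, ?_⟩
  rw [← List.prod_inv_reverse, hs, inv_one]

theorem minimal_inv' {G : Type*} [Group G] {S : Multiset G}
    (hS : IsMinimalProductOne S) : IsMinimalProductOne (S.map (fun g => g⁻¹)) := by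
  obtain ⟨h0, h1, h2⟩ := hS
  refine ⟨by simpa using h0, isProductOne_inv' h1, ?_⟩
  intro T₁ T₂ n1 n2 p1 p2 h
  refine h2 (T₁.map (fun g => g⁻¹)) (T₂.map (fun g => g⁻¹)) (by simpa using n1)
    (by simpa using n2) (isProductOne_inv' p1) (isProductOne_inv' p2) ?_
  rw [← Multiset.map_add, ← h]
  simp

theorem minimal_one' {G : Type*} [Group G] : IsMinimalProductOne ({1} : Multiset G) := by
  refine ⟨by simp, ⟨[1], by simp, by simp⟩, ?_⟩
  intro T₁ T₂ n1 n2 _ _ h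
  have := congrArg Multiset.card h
  have a := Multiset.card_pos.2 n1
  have b := Multiset.card_pos.2 n2
  simp at this
  omega

theorem minimal_pair' {G : Type*} [Group G] {g : G} (hg : g ≠ 1) :
    IsMinimalProductOne ({g, g⁻¹} : Multiset G) := by
  refine ⟨by simp, ⟨[g, g⁻¹], rfl, by simp⟩, ?_⟩
  intro T₁ T₂ n1 n2 p1 p2 h
  have hc := congrArg Multiset.card h
  have a := Multiset.card_pos.2 n1
  have b := Multiset.card_pos.2 n2
  simp at hc
  obtain ⟨x, hx⟩ := Multiset.card_eq_one.1 (show Multiset.card T₁ = 1 by omega)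
  obtain ⟨y, hy⟩ := Multiset.card_eq_one.1 (show Multiset.card T₂ = 1 by omega)
  subst hx hy
  have hx := isProductOne_singleton' p1
  have hy := isProductOne_singleton' p2
  have : g ∈ ({x} + {y} : Multiset G) := by rw [← h]; simp
  simp [hx, hy] at this
  exact hg this

theorem minimal_of_one_mem' {G : Type*} [Group G] {S : Multiset G}
    (hS : IsMinimalProductOne S) (h : (1 : G) ∈ S) : S = {1} := by
  obtain ⟨h0, ⟨s, rfl, hs⟩, h2⟩ := hS
  have h' : (1 : G) ∈ s := by simpa using h
  obtain ⟨a, b, rfl⟩ := List.append_of_mem h'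
  have hp : IsProductOne ((a ++ b : List G) : Multiset G) := ⟨a ++ b, rfl, by simpa using hs⟩
  have he : ((a ++ 1 :: b : List G) : Multiset G) = {1} + ((a ++ b : List G) : Multiset G) := by
    rw [Multiset.singleton_add, Multiset.cons_coe, Multiset.coe_eq_coe]
    exact List.perm_middle
  by_cases hz : ((a ++ b : List G) : Multiset G) = 0
  · rw [he, hz, add_zero]
  · exact absurd he (h2 _ _ (by simp) hz minimal_one'.2.1 hp)

theorem minimal_card_le' {G : Type*} [Group G] [Finite G] {S : Multiset G}
    (hS : IsMinimalProductOne S) : Multiset.card S ≤ Nat.card G := by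
  obtain ⟨h0, ⟨s, rfl, hs⟩, h2⟩ := hS
  by_contra hlt
  push Not at hlt
  rw [Multiset.coe_card] at hlt
  have := Fintype.ofFinite G
  obtain ⟨i, j, hij, he⟩ := Fintype.exists_ne_map_eq_of_card_lt
    (fun i : Fin s.length => (s.take (i.1 + 1)).prod)
    (by simpa [Nat.card_eq_fintype_card] using hlt)
  wlog hlt' : i.1 < j.1 generalizing i j
  · exact this j i hij.symm he.symm (by
      have : i.1 ≠ j.1 := fun h => hij (Fin.ext h)
      omega)
  obtain ⟨i, hi⟩ := i
  obtain ⟨j, hj⟩ := j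
  simp only at he hlt'
  have e1 : s = s.take (i+1) ++ (s.drop (i+1)).take (j - i) ++ s.drop (j+1) := by
    have : s.take (j+1) = s.take (i+1) ++ (s.drop (i+1)).take (j - i) := by
      rw [← List.take_add]; congr 1; omega
    rw [← this, List.take_append_drop]
  have e2 : s.take (j+1) = s.take (i+1) ++ (s.drop (i+1)).take (j - i) := by
    rw [← List.take_add]; congr 1; omega
  have hm : ((s.drop (i+1)).take (j - i)).prod = 1 := by
    rw [e2, List.prod_append] at he
    simpa using he.symm
  have hr : (s.take (i+1) ++ s.drop (j+1)).prod = 1 := by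
    rw [e1] at hs
    rw [List.prod_append, List.prod_append, hm, mul_one] at hs
    rw [List.prod_append, hs]
  refine h2 ((s.take (i+1) ++ s.drop (j+1) : List G) : Multiset G)
    (((s.drop (i+1)).take (j - i) : List G) : Multiset G) ?_ ?_ ⟨_, rfl, hr⟩ ⟨_, rfl, hm⟩ ?_
  · rw [← Multiset.card_pos, Multiset.coe_card]
    simp; omega
  · rw [← Multiset.card_pos, Multiset.coe_card]
    simp; omega
  · conv_lhs => rw [e1]
    simp only [← Multiset.coe_add]
    abel

theorem davenport_bdd' (G : Type*) [Group G] [Finite G] :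
    BddAbove {m | ∃ S : Multiset G, IsMinimalProductOne S ∧ Multiset.card S = m} :=
  ⟨Nat.card G, by rintro m ⟨S, hS, rfl⟩; exact minimal_card_le' hS⟩

theorem card_le_davenport' {G : Type*} [Group G] [Finite G] {S : Multiset G}
    (hS : IsMinimalProductOne S) : Multiset.card S ≤ DavenportLarge G :=
  le_csSup (davenport_bdd' G) ⟨S, hS, rfl⟩

theorem davenport_attained' (G : Type*) [Group G] [Finite G] :
    ∃ S : Multiset G, IsMinimalProductOne S ∧ Multiset.card S = DavenportLarge G :=
  Nat.sSup_mem (s := {m | ∃ S : Multiset G, IsMinimalProductOne S ∧ Multiset.card S = m})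
    ⟨_, {1}, minimal_one', rfl⟩ (davenport_bdd' G)

theorem two_le_davenport' (G : Type*) [Group G] [Finite G] (hG : 3 ≤ Nat.card G) :
    2 ≤ DavenportLarge G := by
  have : Nontrivial G := Finite.one_lt_card_iff_nontrivial.1 (by omega)
  obtain ⟨g, hg⟩ := exists_ne (1 : G)
  simpa using card_le_davenport' (minimal_pair' hg)

theorem hasLength_add' {G : Type*} [Group G] {a b : Multiset G} {k m : ℕ}
    (ha : HasLength a k) (hb : HasLength b m) : HasLength (a + b) (k + m) := by
  obtain ⟨f, hf, rfl⟩ := ha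
  obtain ⟨g, hg, rfl⟩ := hb
  refine ⟨Fin.append f g, fun i => ?_, ?_⟩
  · refine Fin.addCases (fun i => ?_) (fun i => ?_) i
    · simpa using hf i
    · simpa using hg i
  · simp [Fin.sum_univ_add]

theorem hasLength_zero' {G : Type*} [Group G] : HasLength (0 : Multiset G) 0 :=
  ⟨Fin.elim0, fun i => i.elim0, by simp⟩

theorem hasLength_one' {G : Type*} [Group G] {S : Multiset G}
    (h : IsMinimalProductOne S) : HasLength S 1 :=
  ⟨fun _ => S, fun _ => h, by simp⟩

theorem hasLength_nsmul' {G : Type*} [Group G] {a : Multiset G} {k : ℕ}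
    (ha : HasLength a k) (n : ℕ) : HasLength (n • a) (n * k) := by
  induction n with
  | zero => simpa using hasLength_zero'
  | succ n ih =>
    rw [succ_nsmul, Nat.succ_mul]
    exact hasLength_add' ih ha

theorem hasLength_productOne' {G : Type*} [Group G] {a : Multiset G} {k : ℕ}
    (ha : HasLength a k) : IsProductOne a := by
  obtain ⟨f, hf, rfl⟩ := ha
  exact Finset.sum_induction f IsProductOne (fun _ _ => isProductOne_add') isProductOne_zero'
    (fun i _ => (hf i).2.1)

theorem hasLength_pairs' {G : Type*} [Group G] (S : Multiset G) (h : (1 : G) ∉ S) :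
    HasLength (S + S.map (fun g => g⁻¹)) (Multiset.card S) := by
  induction S using Multiset.induction_on with
  | empty => simpa using hasLength_zero'
  | cons g S ih =>
    simp only [Multiset.mem_cons, not_or] at h
    have := hasLength_add' (ih h.2) (hasLength_one' (minimal_pair' (Ne.symm h.1)))
    rw [Multiset.card_cons]
    convert this using 1
    rw [Multiset.map_cons, show ({g, g⁻¹} : Multiset G) = {g} + {g⁻¹} from rfl,
      ← Multiset.singleton_add, ← Multiset.singleton_add]
    abel

theorem upper_mem' (G : Type*) [Group G] [Finite G] (hG : 3 ≤ Nat.card G) (l j : ℕ) :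
    2 * l + j ∈ UnionLengths G (l * DavenportLarge G + j) := by
  obtain ⟨S, hS, hc⟩ := davenport_attained' G
  have hD := two_le_davenport' G hG
  have h1 : (1 : G) ∉ S := by
    intro h
    have := minimal_of_one_mem' hS h
    rw [this] at hc
    simp at hc
    omega
  have hA := hasLength_pairs' S h1
  rw [hc] at hA
  have hB := hasLength_add' (hasLength_one' hS) (hasLength_one' (minimal_inv' hS))
  have hO := hasLength_nsmul' (hasLength_one' (minimal_one' (G := G))) j
  rw [mul_one] at hO
  have h2 := hasLength_add' (hasLength_nsmul' hA l) hO
  have h3 := hasLength_add' (hasLength_nsmul' hB l) hO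
  refine ⟨_, hasLength_productOne' h2, h2, ?_⟩
  convert h3 using 1
  ring

theorem lower_len' {G : Type*} [Group G] [Finite G] (hG : 3 ≤ Nat.card G) {a : Multiset G}
    {k m : ℕ} (hk : HasLength a k) (hm : HasLength a m) :
    2 * k ≤ m * DavenportLarge G := by
  classical
  have hD := two_le_davenport' G hG
  have h1 : 2 * k ≤ Multiset.card a + a.count 1 := by
    obtain ⟨f, hf, rfl⟩ := hk
    rw [Multiset.card_sum, Multiset.count_sum', ← Finset.sum_add_distrib]
    have : ∀ i ∈ Finset.univ, 2 ≤ Multiset.card (f i) + (f i).count 1 := by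
      intro i _
      by_cases h : (1 : G) ∈ f i
      · rw [minimal_of_one_mem' (hf i) h]; simp
      · have hp := Multiset.card_pos.2 (hf i).1
        have : Multiset.card (f i) ≠ 1 := by
          intro hc
          obtain ⟨g, hg⟩ := Multiset.card_eq_one.1 hc
          have h3 := (hf i).2.1
          rw [hg] at h3 h
          exact h (by simp [isProductOne_singleton' h3])
        omega
    have := Finset.card_nsmul_le_sum _ _ _ this
    simp at this
    linarith
  have h2 : Multiset.card a + (DavenportLarge G - 1) * a.count 1 ≤ m * DavenportLarge G := by
    obtain ⟨f, hf, rfl⟩ := hm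
    rw [Multiset.card_sum, Multiset.count_sum', Finset.mul_sum, ← Finset.sum_add_distrib]
    have : ∀ i ∈ Finset.univ, Multiset.card (f i) + (DavenportLarge G - 1) * (f i).count 1
        ≤ DavenportLarge G := by
      intro i _
      by_cases h : (1 : G) ∈ f i
      · rw [minimal_of_one_mem' (hf i) h]; simp; omega
      · rw [Multiset.count_eq_zero_of_notMem h]
        simpa using card_le_davenport' (hf i)
    have := Finset.sum_le_card_nsmul _ _ _ this
    simpa using this
  have h3 : 1 * a.count 1 ≤ (DavenportLarge G - 1) * a.count 1 :=
    Nat.mul_le_mul_right _ (by omega)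
  omega

theorem bounds_aux' (G : Type*) [Group G] [Finite G] (hG : 3 ≤ Nat.card G) (l j : ℕ) :
    2 * (l * DavenportLarge G + j) ≤ lambdaK G (l * DavenportLarge G + j) * DavenportLarge G ∧
      lambdaK G (l * DavenportLarge G + j) ≤ 2 * l + j := by
  have hu := upper_mem' G hG l j
  refine ⟨?_, Nat.sInf_le hu⟩
  obtain ⟨a, _, hk, hm⟩ := Nat.sInf_mem ⟨_, hu⟩
  exact lower_len' hG hk hm

theorem lambda_bounds (G : Type*) [Group G] [Finite G] (hG : 3 ≤ Nat.card G)
    (l j : ℕ) (h1 : 1 ≤ l * DavenportLarge G + j) :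
    ((2 * l + 2 * j / (DavenportLarge G) : ℚ) ≤
        (lambdaK G (l * DavenportLarge G + j) : ℚ) ∧
      lambdaK G (l * DavenportLarge G + j) ≤ 2 * l + j) ∧
    ∀ l' : ℕ, 1 ≤ l' → lambdaK G (l' * DavenportLarge G) = 2 * l' := by
  have hD := two_le_davenport' G hG
  refine ⟨⟨?_, (bounds_aux' G hG l j).2⟩, ?_⟩
  · have h := (bounds_aux' G hG l j).1
    have hq : (0 : ℚ) < DavenportLarge G := by exact_mod_cast (by omega : 0 < DavenportLarge G)
    have h' : (2 * (l * DavenportLarge G + j) : ℚ) ≤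
        lambdaK G (l * DavenportLarge G + j) * DavenportLarge G := by exact_mod_cast h
    have e : (2 * l + 2 * j / (DavenportLarge G) : ℚ) =
        (2 * (l * DavenportLarge G + j)) / DavenportLarge G := by
      field_simp
    rw [e, div_le_iff₀ hq]
    exact h'
  · intro l' _
    obtain ⟨h2, h3⟩ := bounds_aux' G hG l' 0
    simp only [add_zero] at h2 h3
    refine le_antisymm h3 (Nat.le_of_mul_le_mul_right ?_ (by omega : 0 < DavenportLarge G))
    linarith
end
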